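/- arXiv:1509.04622 — 7 statements merged into one kernel-verified Lean document; each statement's English description precedes it below -/
import Mathlib

section
/- Let k ≥ 1 be an integer and let 0 < b < 1/k. Then there is no minimal k-partition 𝒟 = (D₁,…,D_k) of the torus T(1,b) in which some part D_i is homeomorphic to an open disk in ℝ². -/
open Real MeasureTheory Set

noncomputable section

/-- The flat torus `T(a,b) = (ℝ/aℤ) × (ℝ/bℤ)`. -/
abbrev Torus (a b : ℝ) := AddCircle a × AddCircle b

/-- The canonical projection `ℝ² → T(a,b)`. -/
def torusProj (a b : ℝ) (p : ℝ × ℝ) : Torus a b :=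
  ((p.1 : AddCircle a), (p.2 : AddCircle b))

/-- Squared Euclidean norm of the gradient of `f : ℝ² → ℝ` at `p`. -/
def gradSq (f : ℝ × ℝ → ℝ) (p : ℝ × ℝ) : ℝ :=
  (fderiv ℝ f p (1, 0)) ^ 2 + (fderiv ℝ f p (0, 1)) ^ 2

/-- A fundamental domain for the torus `T(a,b)` inside `ℝ²`. -/
def Fund (a b : ℝ) : Set (ℝ × ℝ) := Ioc 0 a ×ˢ Ioc 0 b

/-- The Rayleigh quotient `∫ |∇u|² / ∫ u²` of a function `u` on the torus `T(a,b)`,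
computed by lifting `u` to `ℝ²` and integrating over a fundamental domain. -/
def RayleighT (a b : ℝ) (u : Torus a b → ℝ) : ℝ :=
  (∫ p in Fund a b, gradSq (fun q => u (torusProj a b q)) p) /
    (∫ p in Fund a b, (u (torusProj a b p)) ^ 2)

/-- `u` is an admissible (test) function for the Dirichlet ground state energy of
`D ⊆ T(a,b)`: it is smooth (i.e. its lift to `ℝ²` is `C^∞`), nonzero, and its support is
a compact subset of `D`. -/
def IsTest (a b : ℝ) (D : Set (Torus a b)) (u : Torus a b → ℝ) : Prop :=
  ContDiff ℝ (⊤ : ℕ∞) (fun q : ℝ × ℝ => u (torusProj a b q)) ∧ u ≠ 0 ∧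
    IsCompact (tsupport u) ∧ tsupport u ⊆ D

/-- The ground state energy `λ(D)` of an open set `D ⊆ T(a,b)`:
the infimum of Rayleigh quotients over test functions supported in `D`. -/
def groundEnergy (a b : ℝ) (D : Set (Torus a b)) : ℝ :=
  sInf {r | ∃ u : Torus a b → ℝ, IsTest a b D u ∧ r = RayleighT a b u}

/-- A `k`-partition of the torus `T(a,b)`: a `k`-tuple of pairwise disjoint nonempty
open subsets. -/
def IsPartitionT (a b : ℝ) {k : ℕ} (D : Fin k → Set (Torus a b)) : Prop :=
  (∀ i, IsOpen (D i)) ∧ (∀ i, (D i).Nonempty) ∧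
    ∀ i j, i ≠ j → Disjoint (D i) (D j)

/-- The energy `Λ(𝒟) = max_j λ(D_j)` of a partition. -/
def energyT (a b : ℝ) {k : ℕ} (D : Fin k → Set (Torus a b)) : ℝ :=
  ⨆ i, groundEnergy a b (D i)

/-- The minimal partition energy `𝔏_k(T(a,b))`. -/
def minEnergyT (a b : ℝ) (k : ℕ) : ℝ :=
  sInf {E | ∃ D : Fin k → Set (Torus a b), IsPartitionT a b D ∧ E = energyT a b D}

theorem AddCircle.not_exists_continuous_section {p : ℝ} (hp : p ≠ 0) :
    ¬ ∃ s : AddCircle p → ℝ, Continuous s ∧ ∀ x, (s x : AddCircle p) = x := by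
  rintro ⟨s, hs, hsx⟩
  have hmem : ∀ t : ℝ, ∃ n : ℤ, n • p = s (t : AddCircle p) - t := fun t => by
    rw [← AddCircle.coe_eq_zero_iff, AddCircle.coe_sub, hsx, sub_self]
  have hcont : Continuous fun t : ℝ => (s (t : AddCircle p) - t) / p :=
    ((hs.comp (AddCircle.continuous_mk' p)).sub continuous_id).div_const p
  choose n hn using hmem
  have hval : ∀ t : ℝ, (s (t : AddCircle p) - t) / p = n t := fun t => by
    rw [← hn t, zsmul_eq_mul, mul_div_assoc, div_self hp, mul_one]
  have hncont : Continuous n := by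
    rw [Int.isClosedEmbedding_coe_real.isEmbedding.continuous_iff]
    exact hcont.congr hval
  have hconst : n p = n 0 := PreconnectedSpace.constant inferInstance hncont
  have h := (hval p).trans ((congrArg Int.cast hconst).trans (hval 0).symm)
  rw [AddCircle.coe_period, AddCircle.coe_zero, div_left_inj' hp] at h
  exact hp (by linarith)

/-- A subset of the torus that is homeomorphic to a disk contains no vertical circle. -/
theorem exists_notMem_vertical_of_homeomorph_ball {a b : ℝ} (hb : b ≠ 0) {D : Set (Torus a b)}
    {c : EuclideanSpace ℝ (Fin 2)} {r : ℝ} (hr : 0 < r) (e : ↥D ≃ₜ ↥(Metric.ball c r))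
    (x : AddCircle a) : ∃ y : AddCircle b, (x, y) ∉ D := by
  by_contra! hD
  have : ContractibleSpace (Metric.ball c r) := Metric.contractibleSpace_ball hr
  have : LocallyPathConnectedSpace (Metric.ball c r) :=
    Metric.isOpen_ball.locallyPathConnectedSpace
  let F : C(Metric.ball c r, AddCircle b) := ⟨fun z => (e.symm z : Torus a b).2, by fun_prop⟩
  let z₀ : Metric.ball c r := ⟨c, Metric.mem_ball_self hr⟩
  obtain ⟨t₀, ht₀⟩ := QuotientAddGroup.mk_surjective (F z₀)
  obtain ⟨G, ⟨-, hG⟩, -⟩ :=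
    (AddCircle.isCoveringMap_coe b).existsUnique_continuousMap_lifts F z₀ t₀ ht₀
  refine AddCircle.not_exists_continuous_section hb
    ⟨fun y => G (e ⟨(x, y), hD y⟩), by fun_prop, fun y => ?_⟩
  have := congrFun hG (e ⟨(x, y), hD y⟩)
  simpa [F] using this

/-- The one-dimensional Dirichlet Poincaré inequality with sharp constant, for functions vanishing
near both endpoints. -/
theorem integral_sq_le_integral_deriv_sq {g : ℝ → ℝ} (hg : ContDiff ℝ 1 g) {s L : ℝ} (hL : 0 < L)
    (h₀ : g =ᶠ[nhds s] 0) (h₁ : g =ᶠ[nhds (s + L)] 0) :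
    (π / L) ^ 2 * ∫ x in s..s + L, g x ^ 2 ≤ ∫ x in s..s + L, deriv g x ^ 2 := by
  set c := π / L with hc
  have hcL : c * L = π := by rw [hc]; field_simp
  have hc0 : 0 < c := by positivity
  have hsin : ∀ x ∈ Ioo s (s + L), sin (c * (x - s)) ≠ 0 := fun x hx => by
    refine (sin_pos_of_pos_of_lt_pi (mul_pos hc0 (by linarith [hx.1])) ?_).ne'
    rw [← hcL]
    exact mul_lt_mul_of_pos_left (by linarith [hx.2]) hc0
  have hgd : Differentiable ℝ g := hg.differentiable one_ne_zero
  have hg' : Continuous (deriv g) := hg.continuous_deriv le_rfl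
  have hφ : Continuous fun x => deriv g x ^ 2 - c ^ 2 * g x ^ 2 :=
    (hg'.pow 2).sub (continuous_const.mul (hg.continuous.pow 2))
  let F : ℝ → ℝ := fun x => c * g x ^ 2 * (cos (c * (x - s)) / sin (c * (x - s)))
  have hF0 : ∀ x, g =ᶠ[nhds x] 0 → F =ᶠ[nhds x] fun _ => 0 := fun x hx => by
    filter_upwards [hx] with y hy
    simp [F, hy]
  have hder : ∀ x ∈ Ioo s (s + L), HasDerivAt F
      (2 * c * g x * deriv g x * (cos (c * (x - s)) / sin (c * (x - s)))
        - c ^ 2 * g x ^ 2 * (1 + (cos (c * (x - s)) / sin (c * (x - s))) ^ 2)) x := fun x hx => by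
    have hlin : HasDerivAt (fun y : ℝ => c * (y - s)) c x := by
      simpa using ((hasDerivAt_id x).sub_const s).const_mul c
    have hsx := hsin x hx
    refine ((((hgd x).hasDerivAt.pow 2).const_mul c).mul
      (hlin.cos.div hlin.sin hsx)).congr_deriv ?_
    simp only [Pi.pow_apply, Pi.div_apply]
    field_simp
    ring
  have hcont : ContinuousOn F (Icc s (s + L)) := fun x hx => by
    refine ContinuousAt.continuousWithinAt ?_
    rcases eq_or_lt_of_le hx.1 with rfl | h1
    · exact continuousAt_const.congr (hF0 _ h₀).symm
    rcases eq_or_lt_of_le hx.2 with rfl | h2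
    · exact continuousAt_const.congr (hF0 _ h₁).symm
    exact (hder x ⟨h1, h2⟩).continuousAt
  have key := intervalIntegral.sub_le_integral_of_hasDeriv_right_of_le (by linarith) hcont
    (fun x hx => (hder x hx).hasDerivWithinAt) (hφ.integrableOn_Icc) (fun x _ => by
      nlinarith [sq_nonneg (deriv g x - c * g x * (cos (c * (x - s)) / sin (c * (x - s))))])
  rw [(hF0 _ h₀).eq_of_nhds, (hF0 _ h₁).eq_of_nhds, intervalIntegral.integral_sub
    (Continuous.intervalIntegrable (by fun_prop) _ _)
    (Continuous.intervalIntegrable (by fun_prop) _ _),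
    intervalIntegral.integral_const_mul] at key
  linarith

theorem Function.Periodic.integral_sq_le_integral_deriv_sq {g : ℝ → ℝ} (hg : ContDiff ℝ 1 g)
    {L : ℝ} (hL : 0 < L) (hper : Function.Periodic g L) {s : ℝ} (hs : g =ᶠ[nhds s] 0) :
    (π / L) ^ 2 * ∫ x in 0..L, g x ^ 2 ≤ ∫ x in 0..L, deriv g x ^ 2 := by
  have hs' : g =ᶠ[nhds (s + L)] 0 := by
    have : Filter.Tendsto (fun x => x - L) (nhds (s + L)) (nhds s) := by
      simpa using (continuous_sub_right L).tendsto (s + L)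
    filter_upwards [this.eventually hs] with x hx
    rwa [hper.sub_eq] at hx
  have hper' : Function.Periodic (deriv g) L := fun x => by
    rw [← deriv_comp_add_const, show (fun y => g (y + L)) = g from funext hper]
  have h1 := Function.Periodic.intervalIntegral_add_eq (f := fun x => g x ^ 2) (T := L)
    (fun x => by simp only [hper x]) 0 s
  have h2 := Function.Periodic.intervalIntegral_add_eq (f := fun x => deriv g x ^ 2) (T := L)
    (fun x => by simp only [hper' x]) 0 s
  rw [zero_add] at h1 h2
  rw [h1, h2]
  exact _root_.integral_sq_le_integral_deriv_sq hg hL hs hs'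

theorem continuous_gradSq {f : ℝ × ℝ → ℝ} (hf : ContDiff ℝ 1 f) : Continuous (gradSq f) := by
  have := hf.continuous_fderiv one_ne_zero
  unfold gradSq
  fun_prop

theorem gradSq_nonneg (f : ℝ × ℝ → ℝ) (p : ℝ × ℝ) : 0 ≤ gradSq f p := by
  unfold gradSq
  positivity

theorem RayleighT_nonneg (a b : ℝ) (u : Torus a b → ℝ) : 0 ≤ RayleighT a b u :=
  div_nonneg (integral_nonneg fun _ => gradSq_nonneg _ _) (integral_nonneg fun _ => sq_nonneg _)

theorem setIntegral_Fund {a b : ℝ} (ha : 0 < a) (hb : 0 < b) {f : ℝ × ℝ → ℝ} (hf : Continuous f) :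
    ∫ p in Fund a b, f p = ∫ x in 0..a, ∫ y in 0..b, f (x, y) := by
  have hint : IntegrableOn f (Fund a b) (volume.prod volume) :=
    (hf.continuousOn.integrableOn_compact (isCompact_Icc.prod isCompact_Icc)).mono_set
      (prod_mono Ioc_subset_Icc_self Ioc_subset_Icc_self)
  rw [Fund, Measure.volume_eq_prod, setIntegral_prod f hint, intervalIntegral.integral_of_le ha.le]
  simp only [intervalIntegral.integral_of_le hb.le]

theorem IsTest.integral_sq_pos {a b : ℝ} (ha : 0 < a) (hb : 0 < b) {D : Set (Torus a b)}
    {u : Torus a b → ℝ} (hu : IsTest a b D u) :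
    0 < ∫ p in Fund a b, u (torusProj a b p) ^ 2 := by
  have : Fact (0 < a) := ⟨ha⟩
  have : Fact (0 < b) := ⟨hb⟩
  have hcont : Continuous fun q => u (torusProj a b q) := hu.1.continuous
  have hint : IntegrableOn (fun p => u (torusProj a b p) ^ 2) (Fund a b) :=
    ((hcont.pow 2).continuousOn.integrableOn_compact (isCompact_Icc.prod isCompact_Icc)).mono_set
      (prod_mono Ioc_subset_Icc_self Ioc_subset_Icc_self)
  refine lt_of_le_of_ne (integral_nonneg fun _ => sq_nonneg _) fun h => hu.2.1 ?_
  rw [eq_comm, integral_eq_zero_iff_of_nonneg (fun _ => sq_nonneg _) hint] at h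
  have hEq := Measure.eqOn_of_ae_eq h (hcont.pow 2).continuousOn continuousOn_const (by
    rw [Fund, interior_prod_eq, closure_prod_eq]
    exact prod_mono (Ioc_subset_closure_interior _ _) (Ioc_subset_closure_interior _ _))
  funext ⟨x, y⟩
  obtain ⟨s, hs, rfl⟩ := AddCircle.eq_coe_Ioc x
  obtain ⟨t, ht, rfl⟩ := AddCircle.eq_coe_Ioc y
  simpa [torusProj] using hEq (show (s, t) ∈ Fund a b from ⟨hs, ht⟩)

/-- If `D` contains no vertical circle, Rayleigh quotients on `D` are at least `(π / b)²`. -/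
theorem IsTest.le_RayleighT {a b : ℝ} (ha : 0 < a) (hb : 0 < b) {D : Set (Torus a b)}
    (hD : ∀ x, ∃ y, (x, y) ∉ D) {u : Torus a b → ℝ} (hu : IsTest a b D u) :
    (π / b) ^ 2 ≤ RayleighT a b u := by
  have hpos := hu.integral_sq_pos ha hb
  rw [RayleighT, le_div_iff₀ hpos]
  set f : ℝ × ℝ → ℝ := fun q => u (torusProj a b q) with hf
  have hf1 : ContDiff ℝ 1 f := hu.1.of_le (by exact_mod_cast le_top)
  have hcont : Continuous f := hf1.continuous
  rw [setIntegral_Fund ha hb (continuous_gradSq hf1),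
    show (fun p => u (torusProj a b p) ^ 2) = fun p => f p ^ 2 from rfl,
    setIntegral_Fund ha hb (show Continuous fun p => f p ^ 2 by fun_prop),
    ← intervalIntegral.integral_const_mul]
  have hgc := continuous_gradSq hf1
  refine intervalIntegral.integral_mono_on ha.le (Continuous.intervalIntegrable (by fun_prop) _ _)
    (Continuous.intervalIntegrable (by fun_prop) _ _) fun x _ => ?_
  have hder : ∀ y, HasDerivAt (fun y => f (x, y)) (fderiv ℝ f (x, y) (0, 1)) y := fun y =>
    (hf1.differentiable one_ne_zero (x, y)).hasFDerivAt.comp_hasDerivAt y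
      ((hasDerivAt_const y x).prodMk (hasDerivAt_id y))
  have hper : Function.Periodic (fun y => f (x, y)) b := fun y => by
    simp [hf, torusProj]
  obtain ⟨y, hy⟩ := hD x
  obtain ⟨s, rfl⟩ := QuotientAddGroup.mk_surjective y
  have hs : (fun y => f (x, y)) =ᶠ[nhds s] 0 := by
    have h0 := notMem_tsupport_iff_eventuallyEq.1 fun h => hy (hu.2.2.2 h)
    have : Continuous fun t : ℝ => ((x : AddCircle a), (t : AddCircle b)) :=
      continuous_const.prodMk (AddCircle.continuous_mk' b)
    exact this.continuousAt.eventually h0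
  refine (hper.integral_sq_le_integral_deriv_sq (by fun_prop) hb hs).trans ?_
  refine intervalIntegral.integral_mono_on hb.le ?_
    (Continuous.intervalIntegrable (by fun_prop) _ _) fun y _ => ?_
  · exact Continuous.intervalIntegrable
      (((show ContDiff ℝ 1 fun y => f (x, y) by fun_prop).continuous_deriv le_rfl).pow 2) _ _
  · rw [(hder y).deriv, gradSq]
    exact le_add_of_nonneg_left (sq_nonneg _)

theorem exists_contDiff_cutoff {δ : ℝ} (hδ : 0 < δ) : ∃ ψ : ℝ → ℝ, ContDiff ℝ (⊤ : ℕ∞) ψ ∧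
    (∀ t ≤ δ, ψ t = 0) ∧ (∀ t, deriv ψ t ^ 2 ≤ 1) ∧ ∀ t, 0 ≤ t → t ^ 2 - 4 * δ * t ≤ ψ t ^ 2 := by
  let χ : ℝ → ℝ := fun s => smoothTransition (s / δ - 1)
  have hχ : ContDiff ℝ (⊤ : ℕ∞) χ :=
    smoothTransition.contDiff.comp ((contDiff_id.div_const δ).sub contDiff_const)
  have hχi : ∀ a b, IntervalIntegrable χ volume a b := hχ.continuous.intervalIntegrable
  have hder : ∀ t, HasDerivAt (fun t => ∫ s in 0..t, χ s) (χ t) t := fun t =>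
    intervalIntegral.integral_hasDerivAt_right (hχi _ _)
      (hχ.continuous.stronglyMeasurableAtFilter _ _) hχ.continuous.continuousAt
  have hd : deriv (fun t => ∫ s in 0..t, χ s) = χ := funext fun t => (hder t).deriv
  refine ⟨fun t => ∫ s in 0..t, χ s, ?_, fun t ht => ?_, fun t => ?_, fun t ht => ?_⟩
  · rw [contDiff_infty_iff_deriv, hd]
    exact ⟨fun t => (hder t).differentiableAt, hχ⟩
  · beta_reduce
    rw [intervalIntegral.integral_congr (g := fun _ => (0 : ℝ)), intervalIntegral.integral_zero]
    intro s hs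
    refine smoothTransition.zero_of_nonpos ?_
    rw [sub_nonpos, div_le_one hδ]
    exact hs.2.trans (sup_le hδ.le ht)
  · rw [hd]
    have h0 := smoothTransition.nonneg (t / δ - 1)
    have h1 := smoothTransition.le_one (t / δ - 1)
    exact pow_le_one₀ h0 h1
  · rcases le_total t (2 * δ) with h | h
    · nlinarith [sq_nonneg (∫ s in 0..t, χ s), mul_nonneg ht (sub_nonneg.2 h)]
    · have hsplit : ∫ s in 0..t, χ s = (∫ s in 0..2 * δ, χ s) + (t - 2 * δ) := by
        rw [← intervalIntegral.integral_add_adjacent_intervals (hχi 0 (2 * δ)) (hχi _ t),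
          intervalIntegral.integral_congr (a := 2 * δ) (g := fun _ => (1 : ℝ))]
        · simp
        · intro s hs
          rw [uIcc_of_le h] at hs
          refine smoothTransition.one_of_one_le ?_
          rw [le_sub_iff_add_le, le_div_iff₀ hδ]
          linarith [hs.1]
      have h0 : 0 ≤ ∫ s in 0..2 * δ, χ s :=
        intervalIntegral.integral_nonneg (by positivity) fun s _ => smoothTransition.nonneg _
      simp only [hsplit]
      nlinarith [mul_nonneg h0 (sub_nonneg.2 h)]

/-- The Dirichlet Rayleigh quotient on an interval of length `ℓ` gets arbitrarily close to
`(π / ℓ)²`. -/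
theorem exists_contDiff_integral_deriv_sq_le {α ℓ μ : ℝ} (hℓ : 0 < ℓ) (hμ : (π / ℓ) ^ 2 < μ) :
    ∃ f : ℝ → ℝ, ContDiff ℝ (⊤ : ℕ∞) f ∧ tsupport f ⊆ Ioo α (α + ℓ) ∧ 0 < ∫ x, f x ^ 2 ∧
      ∫ x, deriv f x ^ 2 ≤ μ * ∫ x, f x ^ 2 := by
  set c := π / ℓ with hc
  have hc0 : 0 < c := by positivity
  have hcℓ : c * ℓ = π := by rw [hc]; field_simp
  have hμ0 : 0 < μ := lt_of_le_of_lt (sq_nonneg _) hμ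
  set δ := (1 - c ^ 2 / μ) / 8 with hδ
  have hlt : c ^ 2 / μ < 1 := (div_lt_one hμ0).2 hμ
  have hδ0 : 0 < δ := by rw [hδ]; linarith
  obtain ⟨ψ, hψ, hψ0, hψ1, hψ2⟩ := exists_contDiff_cutoff hδ0
  let θ : ℝ → ℝ := fun x => c * x - c * α
  have hθ : ∀ x, HasDerivAt θ c x := fun x => by
    simpa only [mul_one] using ((hasDerivAt_id' x).const_mul c).sub_const (c * α)
  let h : ℝ → ℝ := fun x => ψ (sin (θ x))
  have hh : ContDiff ℝ (⊤ : ℕ∞) h := by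
    refine hψ.comp (contDiff_sin.comp ?_)
    fun_prop
  have hh' : ∀ x, HasDerivAt h (deriv ψ (sin (θ x)) * (cos (θ x) * c)) x := fun x =>
    ((hψ.differentiable (by simp)) _).hasDerivAt.comp x (hθ x).sin
  let f : ℝ → ℝ := (Ioo α (α + ℓ)).indicator h
  have hθα : sin (θ α) = 0 := by simp [θ]
  have hθβ : sin (θ (α + ℓ)) = 0 := by
    rw [show θ (α + ℓ) = π by simp only [θ]; linarith, sin_pi]
  have hin : ∀ x ∈ Ioo α (α + ℓ), f =ᶠ[nhds x] h := fun x hx => by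
    filter_upwards [isOpen_Ioo.mem_nhds hx] with y hy using indicator_of_mem hy h
  have hout : ∀ x ∉ Ioo α (α + ℓ), f =ᶠ[nhds x] 0 := fun x hx => by
    by_cases hxI : x ∈ Icc α (α + ℓ)
    · have hs : sin (θ x) < δ := by
        rcases eq_or_lt_of_le hxI.1 with rfl | h1
        · rwa [hθα]
        rcases eq_or_lt_of_le hxI.2 with rfl | h2
        · rwa [hθβ]
        exact absurd ⟨h1, h2⟩ hx
      have hcont : Continuous fun y => sin (θ y) := by fun_prop
      filter_upwards [hcont.continuousAt.eventually_lt_const hs] with y hy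
      simp only [f, indicator_apply, h, hψ0 _ hy.le, ite_self, Pi.zero_apply]
    · filter_upwards [isClosed_Icc.isOpen_compl.mem_nhds hxI] with y hy
      exact indicator_of_notMem (fun hy' => hy (Ioo_subset_Icc_self hy')) h
  have hoff : ∀ F : ℝ → ℝ, (∀ x ∉ Ioo α (α + ℓ), F x = 0) →
      ∫ x, F x = ∫ x in α..α + ℓ, F x := fun F hF => by
    rw [intervalIntegral.integral_of_le (by linarith)]
    exact (setIntegral_eq_integral_of_forall_compl_eq_zero fun x hx =>
      hF x fun hx' => hx (Ioo_subset_Ioc_self hx')).symm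
  have hf : ContDiff ℝ (⊤ : ℕ∞) f := contDiff_iff_contDiffAt.2 fun x => by
    by_cases hx : x ∈ Ioo α (α + ℓ)
    · exact hh.contDiffAt.congr_of_eventuallyEq (hin x hx)
    · exact contDiffAt_const.congr_of_eventuallyEq (hout x hx)
  have hf' : Continuous (deriv f) := hf.continuous_deriv (by exact_mod_cast le_top)
  have hL2 : ℓ / 2 - 4 * δ * ℓ ≤ ∫ x, f x ^ 2 := by
    rw [hoff _ fun x hx => by simp [(hout x hx).eq_of_nhds]]
    have hle : ∫ x in α..α + ℓ, (sin (c * x - c * α) ^ 2 - 4 * δ) ≤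
        ∫ x in α..α + ℓ, f x ^ 2 := by
      refine intervalIntegral.integral_mono_on (by linarith)
        (Continuous.intervalIntegrable (by fun_prop) _ _)
        (Continuous.intervalIntegrable (by fun_prop) _ _) fun x hx => ?_
      have hs0 : 0 ≤ sin (θ x) := by
        refine sin_nonneg_of_nonneg_of_le_pi ?_ ?_
        · simp only [θ]; nlinarith [hx.1]
        · simp only [θ]; nlinarith [hx.2]
      by_cases hxI : x ∈ Ioo α (α + ℓ)
      · rw [(hin x hxI).eq_of_nhds]
        have h1 := sin_le_one (θ x)
        have h2 := hψ2 _ hs0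
        simp only [θ, h] at *
        nlinarith
      · have : sin (θ x) = 0 := by
          rcases eq_or_lt_of_le hx.1 with rfl | h1
          · exact hθα
          rcases eq_or_lt_of_le hx.2 with rfl | h2
          · exact hθβ
          exact absurd ⟨h1, h2⟩ hxI
        simp only [θ] at this
        rw [this]
        nlinarith [sq_nonneg (f x)]
    refine le_trans (le_of_eq ?_) hle
    rw [intervalIntegral.integral_sub (Continuous.intervalIntegrable (by fun_prop) _ _)
      (by simp), intervalIntegral.integral_comp_mul_sub (fun x => sin x ^ 2) hc0.ne',
      show c * (α + ℓ) - c * α = π by linarith, sub_self, integral_sin_sq]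
    simp [hc]
    field_simp
  have hH1 : ∫ x, deriv f x ^ 2 ≤ c ^ 2 * (ℓ / 2) := by
    rw [hoff _ fun x hx => by simp [(hout x hx).deriv_eq]]
    have hle : ∫ x in α..α + ℓ, deriv f x ^ 2 ≤
        ∫ x in α..α + ℓ, c ^ 2 * cos (c * x - c * α) ^ 2 := by
      refine intervalIntegral.integral_mono_on (by linarith)
        (Continuous.intervalIntegrable (by fun_prop) _ _)
        (Continuous.intervalIntegrable (by fun_prop) _ _) fun x hx => ?_
      by_cases hxI : x ∈ Ioo α (α + ℓ)
      · rw [(hin x hxI).deriv_eq, (hh' x).deriv, mul_pow, mul_pow]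
        have := mul_le_mul_of_nonneg_right (hψ1 (sin (θ x))) (sq_nonneg (cos (θ x) * c))
        simp only [θ] at *
        nlinarith
      · rw [(hout x hxI).deriv_eq]
        rw [Pi.zero_def, deriv_const, zero_pow two_ne_zero]
        positivity
    refine hle.trans (le_of_eq ?_)
    rw [intervalIntegral.integral_const_mul,
      intervalIntegral.integral_comp_mul_sub (fun x => cos x ^ 2) hc0.ne',
      show c * (α + ℓ) - c * α = π by linarith, sub_self, integral_cos_sq]
    simp [hc, hℓ.ne']
    field_simp
  have hδe : ℓ / 2 - 4 * δ * ℓ = c ^ 2 / μ * (ℓ / 2) := by rw [hδ]; ring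
  rw [hδe] at hL2
  refine ⟨f, hf, fun x hx => ?_, lt_of_lt_of_le (by positivity) hL2, hH1.trans ?_⟩
  · by_contra hxI
    exact notMem_tsupport_iff_eventuallyEq.2 (hout x hxI) hx
  · calc c ^ 2 * (ℓ / 2) = μ * (c ^ 2 / μ * (ℓ / 2)) := by field_simp
      _ ≤ _ := mul_le_mul_of_nonneg_left hL2 hμ0.le

theorem exists_isTest {a b : ℝ} (ha : 0 < a) (hb : 0 < b) {D : Set (Torus a b)} (hDo : IsOpen D)
    (hDn : D.Nonempty) : ∃ u, IsTest a b D u := by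
  have : Fact (0 < a) := ⟨ha⟩
  have : Fact (0 < b) := ⟨hb⟩
  obtain ⟨p₀, hp₀⟩ := hDn
  let g : Torus a b → ℝ := fun p =>
    (AddCircle.toCircle (p.1 - p₀.1) : ℂ).re + (AddCircle.toCircle (p.2 - p₀.2) : ℂ).re
  have hg : Continuous g := by fun_prop
  have hre : ∀ z : Circle, (z : ℂ).re ≤ 1 := fun z =>
    (Complex.re_le_norm _).trans_eq (Circle.norm_coe z)
  have hre1 : ∀ z : Circle, 1 ≤ (z : ℂ).re → z = 1 := fun z hz => by
    have h1 := Circle.normSq_coe z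
    rw [Complex.normSq_apply] at h1
    have hr : (z : ℂ).re = 1 := le_antisymm (hre z) hz
    have hi : (z : ℂ).im = 0 := by
      rw [hr] at h1
      nlinarith
    exact Circle.ext (Complex.ext (by simpa using hr) (by simpa using hi))
  have hlt : ∀ p ∉ D, g p < 2 := fun p hp => by
    by_contra! h
    have h1 := hre1 (AddCircle.toCircle (p.1 - p₀.1)) (by
      linarith [hre (AddCircle.toCircle (p.2 - p₀.2))])
    have h2 := hre1 (AddCircle.toCircle (p.2 - p₀.2)) (by
      linarith [hre (AddCircle.toCircle (p.1 - p₀.1))])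
    rw [← AddCircle.toCircle_zero] at h1 h2
    have e1 := AddCircle.injective_toCircle ha.ne' h1
    have e2 := AddCircle.injective_toCircle hb.ne' h2
    rw [sub_eq_zero] at e1 e2
    exact hp ((Prod.ext e1 e2 : p = p₀) ▸ hp₀)
  obtain ⟨m, hm2, hm⟩ : ∃ m < 2, ∀ p ∉ D, g p ≤ m := by
    rcases Dᶜ.eq_empty_or_nonempty with h | h
    · exact ⟨0, two_pos, fun p hp => (h ▸ hp : p ∈ (∅ : Set (Torus a b))).elim⟩
    · obtain ⟨q, hq, hmax⟩ := hDo.isClosed_compl.isCompact.exists_isMaxOn h hg.continuousOn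
      exact ⟨g q, hlt q hq, fun p hp => hmax hp⟩
  refine ⟨fun p => smoothTransition (g p - (m + 2) / 2), ?_, fun h => ?_,
    (isClosed_tsupport _).isCompact, ?_⟩
  · obtain ⟨⟨x₀⟩, ⟨y₀⟩⟩ := p₀
    have hlift : ∀ q : ℝ × ℝ, g (torusProj a b q) =
        cos (2 * π / a * (q.1 - x₀)) + cos (2 * π / b * (q.2 - y₀)) := fun q => by
      change (AddCircle.toCircle ((q.1 : AddCircle a) - (x₀ : AddCircle a)) : ℂ).re +
        (AddCircle.toCircle ((q.2 : AddCircle b) - (y₀ : AddCircle b)) : ℂ).re = _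
      rw [← AddCircle.coe_sub, ← AddCircle.coe_sub, AddCircle.toCircle_apply_mk,
        AddCircle.toCircle_apply_mk, Circle.coe_exp, Circle.coe_exp, Complex.exp_ofReal_mul_I_re,
        Complex.exp_ofReal_mul_I_re]
    simp only [hlift]
    refine smoothTransition.contDiff.comp ?_
    fun_prop
  · have h2 := congrFun h p₀
    have hg0 : g p₀ = 2 := by simp [g]; norm_num
    simp only [hg0, Pi.zero_apply, smoothTransition.zero_iff_nonpos] at h2
    linarith
  · have hsub : tsupport (fun p => smoothTransition (g p - (m + 2) / 2)) ⊆
        {p | (m + 2) / 2 ≤ g p} := by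
      refine closure_minimal (fun p hp => ?_) (isClosed_le continuous_const hg)
      by_contra hlt'
      exact hp (smoothTransition.zero_of_nonpos (sub_nonpos.2 (not_le.1 hlt').le))
    intro p hp
    by_contra hpD
    have h1 : (m + 2) / 2 ≤ g p := hsub hp
    linarith [hm p hpD]

/-- Near every point, the periodic extension of a function supported inside a period is a
translate of that function. -/
theorem liftIco_eventuallyEq {f : ℝ → ℝ} (hf : tsupport f ⊆ Ioo 0 1) (x : ℝ) :
    (fun y : ℝ => AddCircle.liftIco 1 0 f (y : AddCircle (1 : ℝ))) =ᶠ[nhds x]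
      fun y => f (y - ⌊x⌋) := by
  have hlift : ∀ y : ℝ, AddCircle.liftIco 1 0 f (y : AddCircle (1 : ℝ)) = f (Int.fract y) :=
    fun y => by
      have h : Int.fract y ∈ Ico (0 : ℝ) 1 := ⟨Int.fract_nonneg y, Int.fract_lt_one y⟩
      rw [← AddCircle.liftIco_zero_coe_apply (p := 1) (f := f) h, AddCircle.coe_fract]
  have hlt : ∀ᶠ y in nhds x, y < (⌊x⌋ : ℝ) + 1 := eventually_lt_nhds (Int.lt_floor_add_one x)
  rcases (Int.floor_le x).eq_or_lt with hx | hx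
  · have h0 : f =ᶠ[nhds 0] 0 := notMem_tsupport_iff_eventuallyEq.1 fun h => lt_irrefl _ (hf h).1
    have h1 : f =ᶠ[nhds 1] 0 := notMem_tsupport_iff_eventuallyEq.1 fun h => lt_irrefl _ (hf h).2
    have t0 : Filter.Tendsto (fun y : ℝ => y - ⌊x⌋) (nhds x) (nhds 0) := by
      simpa [hx] using (continuous_sub_right (⌊x⌋ : ℝ)).tendsto x
    have t1 : Filter.Tendsto (fun y : ℝ => y - ⌊x⌋ + 1) (nhds x) (nhds 1) := by
      simpa using t0.add_const 1
    filter_upwards [hlt, t0.eventually h0, t1.eventually h1,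
      eventually_gt_nhds (show (⌊x⌋ : ℝ) - 1 < x by linarith)] with y hy hy0 hy1 hy2
    rw [hlift]
    rcases le_or_gt (⌊x⌋ : ℝ) y with h | h
    · rw [Int.fract, Int.floor_eq_iff.2 ⟨h, hy⟩]
    · have : ⌊y⌋ = ⌊x⌋ - 1 := Int.floor_eq_iff.2 ⟨by push_cast; linarith, by push_cast; linarith⟩
      rw [Int.fract, this, hy0]
      push_cast
      rw [← sub_add, hy1]
      rfl
  · filter_upwards [hlt, eventually_gt_nhds hx] with y hy hy0
    rw [hlift, Int.fract, Int.floor_eq_iff.2 ⟨hy0.le, hy⟩]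

/-- A test function on the line, supported inside `S ⊆ (0, 1)`, gives a test function on the torus
supported in the vertical strip over `S`. -/
theorem isTest_liftIco {b : ℝ} (hb : 0 < b) {f : ℝ → ℝ} (hf : ContDiff ℝ (⊤ : ℕ∞) f) {S : Set ℝ}
    (hS : S ⊆ Ioo 0 1) (hfS : tsupport f ⊆ S) (hf0 : f ≠ 0) :
    IsTest 1 b (((↑) '' S : Set (AddCircle (1 : ℝ))) ×ˢ univ)
      fun p => AddCircle.liftIco 1 0 f p.1 := by
  have : Fact (0 < b) := ⟨hb⟩
  have hf1 := hfS.trans hS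
  refine ⟨?_, fun h => hf0 ?_, (isClosed_tsupport _).isCompact, ?_⟩
  · have h : ContDiff ℝ (⊤ : ℕ∞)
        fun y : ℝ => AddCircle.liftIco 1 0 f (y : AddCircle (1 : ℝ)) :=
      contDiff_iff_contDiffAt.2 fun x =>
        (hf.comp (contDiff_id.sub contDiff_const)).contDiffAt.congr_of_eventuallyEq
          (liftIco_eventuallyEq hf1 x)
    exact h.comp contDiff_fst
  · funext x
    by_cases hx : x ∈ tsupport f
    · have := congrFun h ((x : AddCircle (1 : ℝ)), (0 : AddCircle b))
      simpa only [AddCircle.liftIco_zero_coe_apply (Ioo_subset_Ico_self (hf1 hx)),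
        Pi.zero_apply] using this
    · exact image_eq_zero_of_notMem_tsupport hx
  · have hcpt : IsCompact (tsupport f) :=
      isCompact_Icc.of_isClosed_subset (isClosed_tsupport f) (hf1.trans Ioo_subset_Icc_self)
    refine (closure_minimal (t := ((↑) '' tsupport f) ×ˢ univ) ?_
      ((hcpt.image (AddCircle.continuous_mk' 1)).isClosed.prod isClosed_univ)).trans
      (prod_mono_left (image_mono hfS))
    rintro ⟨x, y⟩ hxy
    obtain ⟨t, ht, rfl⟩ := AddCircle.eq_coe_Ico x
    rw [Function.mem_support, AddCircle.liftIco_zero_coe_apply ht] at hxy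
    exact ⟨⟨t, subset_tsupport f hxy, rfl⟩, mem_univ _⟩

theorem RayleighT_liftIco {b : ℝ} (hb : 0 < b) {f : ℝ → ℝ} (hf : ContDiff ℝ (⊤ : ℕ∞) f)
    (hf1 : tsupport f ⊆ Ioo 0 1) :
    RayleighT 1 b (fun p => AddCircle.liftIco 1 0 f p.1) =
      (∫ x, deriv f x ^ 2) / ∫ x, f x ^ 2 := by
  set G : ℝ → ℝ := fun y => AddCircle.liftIco 1 0 f (y : AddCircle (1 : ℝ)) with hG
  have hfl : ∀ x ∈ Ioo (0 : ℝ) 1, G =ᶠ[nhds x] f := fun x hx => by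
    have := liftIco_eventuallyEq hf1 x
    simpa [Int.floor_eq_zero_iff.2 (Ioo_subset_Ico_self hx)] using this
  have hGd : ContDiff ℝ (⊤ : ℕ∞) G := contDiff_iff_contDiffAt.2 fun x =>
    (hf.comp (contDiff_id.sub contDiff_const)).contDiffAt.congr_of_eventuallyEq
      (liftIco_eventuallyEq hf1 x)
  have hoff : ∀ F : ℝ → ℝ, (∀ x ∉ Ioo (0 : ℝ) 1, F x = 0) →
      ∫ x in Ioo (0 : ℝ) 1, F x = ∫ x, F x := fun F hF =>
    setIntegral_eq_integral_of_forall_compl_eq_zero hF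
  have hgrad : gradSq (fun q => G q.1) = fun q => deriv G q.1 ^ 2 := funext fun q => by
    have h := ((hGd.differentiable (by simp)) q.1).hasDerivAt.hasFDerivAt.comp q
      (hasFDerivAt_fst (𝕜 := ℝ) (p := q))
    have h' : fderiv ℝ (fun q : ℝ × ℝ => G q.1) q = _ := h.fderiv
    rw [gradSq, h']
    simp
  have hGc : Continuous (deriv G) := hGd.continuous_deriv (by exact_mod_cast le_top)
  have hnum : ∫ p in Fund 1 b, gradSq (fun q => G q.1) p = b * ∫ x, deriv f x ^ 2 := by
    rw [hgrad, setIntegral_Fund one_pos hb (by fun_prop),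
      intervalIntegral.integral_of_le zero_le_one, integral_Ioc_eq_integral_Ioo]
    simp only [intervalIntegral.integral_const, sub_zero, smul_eq_mul]
    rw [integral_const_mul, ← hoff _ fun x hx => ?_]
    · congr 1
      exact setIntegral_congr_fun measurableSet_Ioo fun x hx => by
        simp only [(hfl x hx).deriv_eq]
    · have h0 := notMem_tsupport_iff_eventuallyEq.1 fun h => hx (hf1 h)
      simp [h0.deriv_eq]
  have hden : ∫ p in Fund 1 b, G p.1 ^ 2 = b * ∫ x, f x ^ 2 := by
    have := hGd.continuous
    rw [setIntegral_Fund one_pos hb (by fun_prop), intervalIntegral.integral_of_le zero_le_one,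
      integral_Ioc_eq_integral_Ioo]
    simp only [intervalIntegral.integral_const, sub_zero, smul_eq_mul]
    rw [integral_const_mul, ← hoff _ fun x hx => ?_]
    · congr 1
      exact setIntegral_congr_fun measurableSet_Ioo fun x hx => by
        simp only [(hfl x hx).eq_of_nhds]
    · simp [image_eq_zero_of_notMem_tsupport fun h => hx (hf1 h)]
  exact (congrArg₂ (· / ·) hnum hden).trans (mul_div_mul_left _ _ hb.ne')

theorem groundEnergy_le {a b : ℝ} {D : Set (Torus a b)} {u : Torus a b → ℝ}
    (hu : IsTest a b D u) : groundEnergy a b D ≤ RayleighT a b u :=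
  csInf_le ⟨0, by rintro _ ⟨v, -, rfl⟩; exact RayleighT_nonneg a b v⟩ ⟨u, hu, rfl⟩

theorem groundEnergy_nonneg (a b : ℝ) (D : Set (Torus a b)) : 0 ≤ groundEnergy a b D :=
  Real.sInf_nonneg (by rintro _ ⟨u, -, rfl⟩; exact RayleighT_nonneg a b u)

theorem le_groundEnergy {a b : ℝ} (ha : 0 < a) (hb : 0 < b) {D : Set (Torus a b)}
    (hDo : IsOpen D) (hDn : D.Nonempty) (hD : ∀ x, ∃ y, (x, y) ∉ D) :
    (π / b) ^ 2 ≤ groundEnergy a b D := by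
  obtain ⟨u, hu⟩ := exists_isTest ha hb hDo hDn
  refine le_csInf ⟨_, u, hu, rfl⟩ ?_
  rintro _ ⟨v, hv, rfl⟩
  exact hv.le_RayleighT ha hb hD

theorem minEnergyT_le {a b : ℝ} {k : ℕ} {D : Fin k → Set (Torus a b)} (hD : IsPartitionT a b D) :
    minEnergyT a b k ≤ energyT a b D := by
  refine csInf_le ⟨0, ?_⟩ ⟨D, hD, rfl⟩
  rintro _ ⟨E, -, rfl⟩
  exact Real.iSup_nonneg fun i => groundEnergy_nonneg a b (E i)

theorem groundEnergy_le_energyT {a b : ℝ} {k : ℕ} (D : Fin k → Set (Torus a b)) (i : Fin k) :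
    groundEnergy a b (D i) ≤ energyT a b D :=
  le_ciSup (f := fun i => groundEnergy a b (D i)) (finite_range _).bddAbove i

/-- The partition of `T(1,b)` into `k` equal vertical strips has energy at most `(π k)²`. -/
theorem minEnergyT_le_of_lt {b : ℝ} (hb : 0 < b) {k : ℕ} (hk : 1 ≤ k) {μ : ℝ}
    (hμ : (π * k) ^ 2 < μ) : minEnergyT 1 b k ≤ μ := by
  have hk0 : (0 : ℝ) < k := by exact_mod_cast hk
  have : Nonempty (Fin k) := ⟨⟨0, hk⟩⟩
  let S : Fin k → Set ℝ := fun i => Ioo ((i : ℝ) / k) ((i : ℝ) / k + 1 / k)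
  have hS : ∀ i, S i ⊆ Ioo 0 1 := fun i => by
    refine Ioo_subset_Ioo (by positivity) ?_
    rw [← add_div, div_le_one hk0]
    exact_mod_cast i.2
  have hSd : ∀ i j, i < j → Disjoint (S i) (S j) := fun i j hij => by
    rw [Set.disjoint_left]
    intro x hx hx'
    have h : (i : ℝ) / k + 1 / k ≤ j / k := by
      rw [← add_div]
      gcongr
      exact_mod_cast hij
    linarith [hx.2, hx'.1]
  let D : Fin k → Set (Torus 1 b) := fun i => ((↑) '' S i : Set (AddCircle (1 : ℝ))) ×ˢ univ
  have hD : IsPartitionT 1 b D := by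
    refine ⟨fun i => (QuotientAddGroup.isOpenMap_coe _ isOpen_Ioo).prod isOpen_univ, fun i => ?_,
      fun i j hij => ?_⟩
    · refine ((nonempty_Ioo.2 ?_).image _).prod univ_nonempty
      linarith [one_div_pos.2 hk0]
    · refine Set.disjoint_prod.2 (Or.inl ?_)
      have hd : Disjoint (S i) (S j) := by
        rcases hij.lt_or_gt with h | h
        exacts [hSd i j h, (hSd j i h).symm]
      rw [Set.disjoint_left]
      rintro _ ⟨x, hx, rfl⟩ ⟨y, hy, hxy⟩
      have hx' : x ∈ Ico (0 : ℝ) (0 + 1) := by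
        rw [zero_add]; exact Ioo_subset_Ico_self (hS i hx)
      have hy' : y ∈ Ico (0 : ℝ) (0 + 1) := by
        rw [zero_add]; exact Ioo_subset_Ico_self (hS j hy)
      have := (AddCircle.coe_eq_coe_iff_of_mem_Ico hy' hx').1 hxy
      exact Set.disjoint_left.1 hd hx (this ▸ hy)
  refine (minEnergyT_le hD).trans (ciSup_le fun i => ?_)
  obtain ⟨f, hf, hfS, hpos, hle⟩ := exists_contDiff_integral_deriv_sq_le (α := (i : ℝ) / k)
    (one_div_pos.2 hk0) (show (π / (1 / k)) ^ 2 < μ by rwa [div_div_eq_mul_div, div_one])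
  have hf0 : f ≠ 0 := by
    rintro rfl
    simp at hpos
  refine (groundEnergy_le (isTest_liftIco hb hf (hS i) hfS hf0)).trans ?_
  rw [RayleighT_liftIco hb hf (hfS.trans (hS i)), div_le_iff₀ hpos]
  exact hle

/-- For `k ≥ 1` and `0 < b < 1/k`, there is no minimal `k`-partition of
`T(1,b)` in which some part is homeomorphic to an open disk in `ℝ²`. -/
theorem statement2 (k : ℕ) (hk : 1 ≤ k) (b : ℝ) (hb : 0 < b) (hbk : b < 1 / (k : ℝ)) :
    ¬ ∃ D : Fin k → Set (Torus 1 b), IsPartitionT 1 b D ∧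
      energyT 1 b D = minEnergyT 1 b k ∧
      ∃ (i : Fin k) (c : EuclideanSpace ℝ (Fin 2)) (r : ℝ), 0 < r ∧
        Nonempty (↥(D i) ≃ₜ ↥(Metric.ball c r)) := by
  rintro ⟨D, hD, hmin, i, c, r, hr, ⟨e⟩⟩
  have hk0 : (0 : ℝ) < k := by exact_mod_cast hk
  have hkb : (k : ℝ) < 1 / b := (lt_one_div hb hk0).1 hbk
  have hlt : (π * k) ^ 2 < (π / b) ^ 2 := by
    rw [div_eq_mul_one_div]
    gcongr
  obtain ⟨μ, hμ, hμb⟩ := exists_between hlt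
  have h1 := minEnergyT_le_of_lt hb hk hμ
  have h2 := le_groundEnergy one_pos hb (hD.1 i) (hD.2.1 i)
    (exists_notMem_vertical_of_homeomorph_ball hb.ne' hr e)
  have h3 := groundEnergy_le_energyT D i
  linarith
end
end

section
/- Let b > 0 and let U ⊆ ℝ be an open set whose Lebesgue measure is at most b. Then every smooth compactly supported function u : ℝ → ℝ vanishing outside U satisfies ∫_ℝ u′(t)² dt ≥ (π²/b²) ∫_ℝ u(t)² dt. -/
open Real MeasureTheory

open Filter Topology Asymptotics

/-- If an open set `U` has measure at most `b`, there is a continuous function with values in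
`[0, b]` and derivative one on `U`, namely the measure of the part of `U` to the left of `t`. -/
lemma exists_continuous_hasDerivAt_one_of_volume_le {b : ℝ} (hb : 0 ≤ b) {U : Set ℝ}
    (hU : IsOpen U) (hUb : volume U ≤ ENNReal.ofReal b) :
    ∃ φ : ℝ → ℝ, Continuous φ ∧ (∀ t, 0 ≤ φ t ∧ φ t ≤ b) ∧ ∀ t ∈ U, HasDerivAt φ 1 t := by
  have hfin : volume U ≠ ⊤ := ne_top_of_le_ne_top ENNReal.ofReal_ne_top hUb
  set f : ℝ → ℝ := U.indicator 1 with hf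
  have hf0 : ∀ t, 0 ≤ f t := fun t => Set.indicator_nonneg (fun _ _ => zero_le_one) t
  have hint : Integrable f :=
    (integrable_indicator_iff hU.measurableSet).2 (integrableOn_const hfin)
  have hφ : ∀ t, ∫ x in Set.Iic t, f x = (∫ x in Set.Iic 0, f x) + ∫ x in (0 : ℝ)..t, f x := by
    intro t
    rw [← intervalIntegral.integral_Iic_sub_Iic hint.integrableOn hint.integrableOn]
    ring
  refine ⟨fun t => ∫ x in Set.Iic t, f x, ?_, fun t => ⟨?_, ?_⟩, fun t ht => ?_⟩
  · rw [funext hφ]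
    exact continuous_const.add
      (intervalIntegral.continuous_primitive (fun _ _ => hint.intervalIntegrable) 0)
  · exact integral_nonneg hf0
  · calc ∫ x in Set.Iic t, f x ≤ ∫ x, f x :=
          setIntegral_le_integral hint (Eventually.of_forall hf0)
      _ = volume.real U := integral_indicator_one hU.measurableSet
      _ ≤ b := ENNReal.toReal_le_of_le_ofReal hb hUb
  · rw [funext hφ]
    have hev : f =ᶠ[𝓝 t] fun _ => 1 := by
      filter_upwards [hU.mem_nhds ht] with s hs
      simp [hf, hs]
    have h := intervalIntegral.integral_hasDerivAt_right
      (hint.intervalIntegrable (a := 0) (b := t))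
      hint.aestronglyMeasurable.stronglyMeasurableAtFilter
      (continuousAt_const.congr hev.symm)
    rw [hev.eq_of_nhds] at h
    exact h.const_add _

/-- A continuous function times the square of a differentiable function has derivative zero at
each zero of the latter. -/
lemma hasDerivAt_mul_sq_of_eq_zero {w u : ℝ → ℝ} {t d : ℝ} (hw : ContinuousAt w t)
    (hu : HasDerivAt u d t) (h0 : u t = 0) : HasDerivAt (fun s => w s * u s ^ 2) 0 t := by
  have hsq : HasDerivAt (fun s => u s ^ 2) 0 t := by
    exact (hu.pow 2).congr_deriv (by simp [h0])
  rw [hasDerivAt_iff_isLittleO] at hsq ⊢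
  simpa [h0] using (hw.isBigO_one ℝ).mul_isLittleO hsq

/-- The Poincaré inequality with a constant strictly below the optimal one. -/
lemma sq_mul_integral_sq_le_of_lt {b c : ℝ} (hb : 0 < b) (hc : 0 < c) (hcb : c < π / b)
    {U : Set ℝ} (hU : IsOpen U) (hUb : volume U ≤ ENNReal.ofReal b) {u : ℝ → ℝ}
    (hu : ContDiff ℝ 1 u) (hsupp : HasCompactSupport u) (hvan : ∀ t ∉ U, u t = 0) :
    c ^ 2 * ∫ t, u t ^ 2 ≤ ∫ t, deriv u t ^ 2 := by
  obtain ⟨φ, hφ, hφb, hφ'⟩ := exists_continuous_hasDerivAt_one_of_volume_le hb.le hU hUb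
  rw [lt_div_iff₀ hb] at hcb
  set θ : ℝ → ℝ := fun t => c * φ t + (π - c * b) / 2 with hθ
  have hsin : ∀ t, sin (θ t) ≠ 0 := fun t => by
    have h0 : 0 ≤ c * φ t := mul_nonneg hc.le (hφb t).1
    have h1 : c * φ t ≤ c * b := mul_le_mul_of_nonneg_left (hφb t).2 hc.le
    exact (sin_pos_of_pos_of_lt_pi (by simp only [hθ]; linarith)
      (by simp only [hθ]; linarith)).ne'
  have hθc : Continuous θ := by fun_prop
  set w : ℝ → ℝ := fun t => c * (cos (θ t) / sin (θ t)) with hw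
  have hwc : Continuous w :=
    continuous_const.mul ((continuous_cos.comp hθc).div (continuous_sin.comp hθc) hsin)
  have hw' : ∀ t ∈ U, HasDerivAt w (-c ^ 2 - w t ^ 2) t := fun t ht => by
    have h1 : HasDerivAt θ c t :=
      (((hφ' t ht).const_mul c).add_const ((π - c * b) / 2)).congr_deriv (mul_one c)
    refine ((h1.cos.div h1.sin (hsin t)).const_mul c).congr_deriv ?_
    simp only [hw]
    have := hsin t
    field_simp
  have hud : ∀ t, HasDerivAt u (deriv u t) t := fun t =>
    (hu.differentiable one_ne_zero t).hasDerivAt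
  have huc : Continuous u := hu.continuous
  have hu'c : Continuous (deriv u) := hu.continuous_deriv le_rfl
  have hsq : HasCompactSupport fun t => u t ^ 2 :=
    hsupp.comp_left (g := fun x => x ^ 2) (by simp)
  have hsq' : HasCompactSupport fun t => deriv u t ^ 2 :=
    hsupp.deriv.comp_left (g := fun x => x ^ 2) (by simp)
  set G : ℝ → ℝ := fun t => (-c ^ 2 - w t ^ 2) * u t ^ 2 + w t * (2 * u t * deriv u t) with hG
  have hderiv : ∀ t, HasDerivAt (fun s => w s * u s ^ 2) (G t) t := fun t => by
    by_cases ht : t ∈ U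
    · exact ((hw' t ht).mul ((hud t).pow 2)).congr_deriv (by simp [hG])
    · simpa [hG, hvan t ht] using
        hasDerivAt_mul_sq_of_eq_zero hwc.continuousAt (hud t) (hvan t ht)
  have hGint : Integrable G := by
    refine Continuous.integrable_of_hasCompactSupport (by fun_prop) (hsupp.mono fun t ht => ?_)
    contrapose! ht
    simp_all
  have hG0 : ∫ t, G t = 0 :=
    integral_eq_zero_of_hasDerivAt_of_integrable hderiv hGint
      ((hwc.mul (huc.pow 2)).integrable_of_hasCompactSupport hsq.mul_left)
  have hi : Integrable fun t => u t ^ 2 := (huc.pow 2).integrable_of_hasCompactSupport hsq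
  have hi' : Integrable fun t => deriv u t ^ 2 :=
    (hu'c.pow 2).integrable_of_hasCompactSupport hsq'
  calc c ^ 2 * ∫ t, u t ^ 2 = ∫ t, (c ^ 2 * u t ^ 2 + G t) := by
        rw [integral_add (hi.const_mul _) hGint, hG0, integral_const_mul, add_zero]
    _ ≤ ∫ t, deriv u t ^ 2 := by
        refine integral_mono ((hi.const_mul _).add hGint) hi' fun t => ?_
        simp only [hG]
        nlinarith [sq_nonneg (deriv u t - w t * u t)]

/-- 1D Faber–Krahn/Poincaré inequality. Let `b > 0` and let `U ⊆ ℝ` be an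
open set of Lebesgue measure at most `b`. Then every smooth compactly supported function
`u : ℝ → ℝ` vanishing outside `U` satisfies `∫ u′² ≥ (π²/b²) ∫ u²`. -/
theorem statement4 (b : ℝ) (hb : 0 < b) (U : Set ℝ) (hU : IsOpen U)
    (hUb : volume U ≤ ENNReal.ofReal b)
    (u : ℝ → ℝ) (hu : ContDiff ℝ (⊤ : ℕ∞) u) (hsupp : HasCompactSupport u)
    (hvan : ∀ t ∉ U, u t = 0) :
    (π ^ 2 / b ^ 2) * ∫ t : ℝ, (u t) ^ 2 ≤ ∫ t : ℝ, (deriv u t) ^ 2 := by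
  have hlim : Tendsto (fun c : ℝ => c ^ 2 * ∫ t : ℝ, (u t) ^ 2) (𝓝[<] (π / b))
      (𝓝 ((π / b) ^ 2 * ∫ t : ℝ, (u t) ^ 2)) :=
    ((continuous_id.pow 2).mul continuous_const).continuousWithinAt
  rw [← div_pow]
  refine le_of_tendsto hlim ?_
  filter_upwards [Ioo_mem_nhdsLT (div_pos pi_pos hb)] with c hc
  exact sq_mul_integral_sq_le_of_lt hb hc.1 hc.2 hU hUb (hu.of_le (by exact_mod_cast le_top))
    hsupp hvan
end

section
/- Let λ, θ ∈ ℝ with λ ≠ 0 and cos θ ≠ 0, and define u_{λ,θ}(x,y) = cos(2πx)·cos(2πy + θ) + λ·sin(2πx)·sin(2πy) on ℝ². Then the nodal set of u_{λ,θ} contains no critical zero: there is no point (x,y) ∈ ℝ² at which u_{λ,θ}, ∂u_{λ,θ}/∂x, and ∂u_{λ,θ}/∂y all vanish simultaneously. -/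
open Real

/-- Let `λ ≠ 0` and `cos θ ≠ 0`, and let
`u(x,y) = cos(2πx)cos(2πy + θ) + λ sin(2πx)sin(2πy)` on `ℝ²`. Then the nodal set of `u`
contains no critical zero: there is no point where `u` and its gradient (equivalently,
both partial derivatives) vanish simultaneously. -/
theorem statement8 (lam θ : ℝ) (hlam : lam ≠ 0) (hθ : Real.cos θ ≠ 0) :
    ¬ ∃ p : ℝ × ℝ,
      (Real.cos (2 * π * p.1) * Real.cos (2 * π * p.2 + θ)
          + lam * Real.sin (2 * π * p.1) * Real.sin (2 * π * p.2) = 0) ∧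
      fderiv ℝ (fun q : ℝ × ℝ => Real.cos (2 * π * q.1) * Real.cos (2 * π * q.2 + θ)
          + lam * Real.sin (2 * π * q.1) * Real.sin (2 * π * q.2)) p = 0 := by
  rintro ⟨⟨x, y⟩, hu, hgrad⟩
  have hdiff : DifferentiableAt ℝ (fun q : ℝ × ℝ => Real.cos (2 * π * q.1) *
      Real.cos (2 * π * q.2 + θ) + lam * Real.sin (2 * π * q.1) * Real.sin (2 * π * q.2))
      (x, y) := by fun_prop
  have hline : HasDerivAt (fun t : ℝ => (t, y)) (1, 0) x :=
    (hasDerivAt_id x).prodMk (hasDerivAt_const x y)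
  have hzero := hdiff.hasFDerivAt.comp_hasDerivAt x hline
  rw [hgrad] at hzero
  have hlin : HasDerivAt (fun t : ℝ => 2 * π * t) (2 * π) x := by
    simpa using (hasDerivAt_id x).const_mul (2 * π)
  have hpartial := (hlin.cos.mul_const (Real.cos (2 * π * y + θ))).add
    ((hlin.sin.const_mul lam).mul_const (Real.sin (2 * π * y)))
  have hux := hpartial.unique hzero
  simp only [zero_apply] at hu hux
  have hπ : (2 * π) ≠ 0 := by positivity
  have hux' : -Real.sin (2 * π * x) * Real.cos (2 * π * y + θ)
      + lam * Real.cos (2 * π * x) * Real.sin (2 * π * y) = 0 := by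
    apply mul_left_cancel₀ hπ
    linear_combination hux
  have hx := Real.sin_sq_add_cos_sq (2 * π * x)
  have hsin : Real.sin (2 * π * y) = 0 := by
    apply mul_left_cancel₀ hlam
    linear_combination Real.sin (2 * π * x) * hu + Real.cos (2 * π * x) * hux' -
      lam * Real.sin (2 * π * y) * hx
  have hcos : Real.cos (2 * π * y + θ) = 0 := by
    linear_combination Real.cos (2 * π * x) * hu - Real.sin (2 * π * x) * hux' -
      Real.cos (2 * π * y + θ) * hx
  rw [Real.cos_add, hsin, zero_mul, sub_zero] at hcos
  have hy := Real.sin_sq_add_cos_sq (2 * π * y)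
  simp [hsin, (mul_eq_zero.mp hcos).resolve_right hθ] at hy
end

section
/- Let m, n ≥ 1 be integers and λ, θ ∈ ℝ with λ ≠ 0 and cos θ ≠ 0. The function u on the torus (ℝ/ℤ)² given by u(x,y) = cos(2πmx)·cos(2πny + θ) + λ·sin(2πmx)·sin(2πny) has exactly 2·gcd(m,n) nodal domains. -/
open Real

/-- A locally constant map with connected fibres identifies connected components with values. -/
theorem natCard_connectedComponents_eq_of_isConnected_fiber {Y I : Type*} [TopologicalSpace Y]
    (f : Y → I) (ho : ∀ j, IsOpen (f ⁻¹' {j})) (hc : ∀ j, IsConnected (f ⁻¹' {j})) :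
    Nat.card (ConnectedComponents Y) = Nat.card I := by
  let _ : TopologicalSpace I := ⊥
  have _ : DiscreteTopology I := ⟨rfl⟩
  have hf : Continuous f := continuous_discrete_rng.2 ho
  refine Nat.card_eq_of_bijective hf.connectedComponentsLift ⟨?_, ?_⟩
  · intro a b hab
    obtain ⟨a, rfl⟩ := ConnectedComponents.surjective_coe a
    obtain ⟨b, rfl⟩ := ConnectedComponents.surjective_coe b
    simp only [Continuous.connectedComponentsLift_apply_coe] at hab
    rw [ConnectedComponents.coe_eq_coe']
    exact (hc (f b)).isPreconnected.subset_connectedComponent rfl hab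
  · intro j
    obtain ⟨y, hy⟩ := (hc j).nonempty
    exact ⟨(y : ConnectedComponents Y), by simpa using hy⟩

/-- An ellipse traced as `α e^{ib} + β e^{-ib}` with `‖β‖ < ‖α‖` has a continuous argument
winding once around the origin. -/
theorem exists_continuous_arg_ellipse {α β : ℂ} (h : ‖β‖ < ‖α‖) :
    ∃ φ : ℝ → ℝ, Continuous φ ∧ (∀ b, φ (b + 2 * π) = φ b + 2 * π) ∧
      ∀ b : ℝ, ∃ r : ℝ, 0 < r ∧ α * Complex.exp (b * Complex.I) +
        β * Complex.exp (-b * Complex.I) = r * Complex.exp (φ b * Complex.I) := by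
  have hα : α ≠ 0 := norm_pos_iff.1 ((norm_nonneg β).trans_lt h)
  set q : ℝ → ℂ := fun b => 1 + β / α * Complex.exp (((-2 * b : ℝ) : ℂ) * Complex.I) with hq
  have hqc : Continuous q := by fun_prop
  have hqs : ∀ b, q b ∈ Complex.slitPlane := by
    intro b
    left
    have h1 : ‖β / α * Complex.exp (((-2 * b : ℝ) : ℂ) * Complex.I)‖ < 1 := by
      rw [norm_mul, Complex.norm_exp_ofReal_mul_I, mul_one, norm_div]
      exact (div_lt_one (norm_pos_iff.2 hα)).2 h
    have h2 := (abs_le.1 (Complex.abs_re_le_norm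
      (β / α * Complex.exp (((-2 * b : ℝ) : ℂ) * Complex.I)))).1
    simp only [hq, Complex.add_re, Complex.one_re]
    linarith
  refine ⟨fun b => b + α.arg + (q b).arg, ?_, ?_, ?_⟩
  · refine (continuous_id.add continuous_const).add ?_
    exact continuous_iff_continuousAt.2 fun b =>
      (Complex.continuousAt_arg (hqs b)).comp hqc.continuousAt
  · intro b
    have : q (b + 2 * π) = q b := by
      simp only [hq]
      congr 2
      rw [Complex.exp_eq_exp_iff_exists_int]
      exact ⟨-2, by push_cast; ring⟩
    simp only [this]
    ring
  · intro b
    refine ⟨‖α‖ * ‖q b‖, mul_pos (norm_pos_iff.2 hα)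
      (norm_pos_iff.2 (Complex.slitPlane_ne_zero (hqs b))), ?_⟩
    have e1 : α * Complex.exp (b * Complex.I) + β * Complex.exp (-b * Complex.I) =
        Complex.exp (b * Complex.I) * α * q b := by
      have : Complex.exp (-b * Complex.I) = Complex.exp (b * Complex.I) *
          Complex.exp (((-2 * b : ℝ) : ℂ) * Complex.I) := by
        rw [← Complex.exp_add]
        congr 1
        push_cast
        ring
      rw [this]
      simp only [hq]
      field_simp
    rw [e1]
    conv_lhs => rw [← Complex.norm_mul_exp_arg_mul_I α, ← Complex.norm_mul_exp_arg_mul_I (q b)]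
    push_cast
    rw [add_mul, add_mul, Complex.exp_add, Complex.exp_add]
    ring

/-- Polar coordinates along the closed curve `b ↦ (cos (b + θ), lam * sin b)`. -/
theorem exists_continuous_polar {lam θ : ℝ} (hlam : lam ≠ 0) (hθ : cos θ ≠ 0) :
    ∃ (φ : ℝ → ℝ) (w : ℤ), Continuous φ ∧ (w = 1 ∨ w = -1) ∧
      (∀ b, φ (b + 2 * π) = φ b + 2 * π * w) ∧
      ∀ b, ∃ r, 0 < r ∧ cos (b + θ) = r * cos (φ b) ∧ lam * sin b = r * sin (φ b) := by
  set α : ℂ := ⟨(cos θ + lam) / 2, sin θ / 2⟩ with hα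
  set β : ℂ := ⟨(cos θ - lam) / 2, -sin θ / 2⟩ with hβ
  have key : ∀ b : ℝ, α * Complex.exp (b * Complex.I) + β * Complex.exp (-b * Complex.I) =
      ⟨cos (b + θ), lam * sin b⟩ := by
    intro b
    rw [← Complex.ofReal_neg]
    apply Complex.ext
    · simp only [hα, hβ, Complex.add_re, Complex.mul_re, Complex.exp_ofReal_mul_I_re,
        Complex.exp_ofReal_mul_I_im, cos_neg, sin_neg, cos_add]
      ring
    · simp only [hα, hβ, Complex.add_im, Complex.mul_im, Complex.exp_ofReal_mul_I_re,
        Complex.exp_ofReal_mul_I_im, cos_neg, sin_neg]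
      ring
  have polar : ∀ b r t : ℝ, α * Complex.exp (b * Complex.I) + β * Complex.exp (-b * Complex.I) =
      r * Complex.exp (t * Complex.I) → cos (b + θ) = r * cos t ∧ lam * sin b = r * sin t := by
    intro b r t h
    rw [key] at h
    have h1 := congrArg Complex.re h
    have h2 := congrArg Complex.im h
    rw [Complex.re_ofReal_mul, Complex.exp_ofReal_mul_I_re] at h1
    rw [Complex.im_ofReal_mul, Complex.exp_ofReal_mul_I_im] at h2
    exact ⟨h1, h2⟩
  have hne : ‖β‖ ≠ ‖α‖ := by
    intro h
    have h2 : Complex.normSq β = Complex.normSq α := by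
      rw [Complex.normSq_eq_norm_sq, Complex.normSq_eq_norm_sq, h]
    simp only [hα, hβ, Complex.normSq_mk] at h2
    exact mul_ne_zero hlam hθ (by linarith)
  rcases hne.lt_or_gt with h | h
  · obtain ⟨φ, hφ, hper, hpol⟩ := exists_continuous_arg_ellipse h
    refine ⟨φ, 1, hφ, Or.inl rfl, fun b => by simp [hper], fun b => ?_⟩
    obtain ⟨r, hr, e⟩ := hpol b
    exact ⟨r, hr, polar b r _ e⟩
  · obtain ⟨φ, hφ, hper, hpol⟩ := exists_continuous_arg_ellipse h
    refine ⟨fun b => φ (-b), -1, hφ.comp continuous_neg, Or.inr rfl, fun b => ?_, fun b => ?_⟩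
    · have := hper (-(b + 2 * π))
      rw [show -(b + 2 * π) + 2 * π = -b by ring] at this
      push_cast
      linarith
    · obtain ⟨r, hr, e⟩ := hpol (-b)
      refine ⟨r, hr, polar b r _ ?_⟩
      rw [← e]
      push_cast
      rw [neg_neg, add_comm]

theorem cos_pi_mul_ne_zero_iff (t : ℝ) :
    cos (π * t) ≠ 0 ↔ ∃ k : ℤ, (k : ℝ) - 1 / 2 < t ∧ t < k + 1 / 2 := by
  constructor
  · intro h
    refine ⟨⌊t + 1 / 2⌋, lt_of_le_of_ne ?_ fun e => h ?_, ?_⟩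
    · linarith [Int.floor_le (t + 1 / 2)]
    · rw [cos_eq_zero_iff]
      refine ⟨⌊t + 1 / 2⌋ - 1, ?_⟩
      conv_lhs => rw [← e]
      push_cast
      ring
    · linarith [Int.lt_floor_add_one (t + 1 / 2)]
  · rintro ⟨k, h1, h2⟩ h
    obtain ⟨l, hl⟩ := cos_eq_zero_iff.1 h
    have ht : t = l + 1 / 2 := by
      have := pi_pos.ne'
      field_simp at hl
      linarith
    rw [ht] at h1 h2
    have a : k < l + 1 := by
      have : (k : ℝ) < l + 1 := by linarith
      exact_mod_cast this
    have b : l < k := by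
      have : (l : ℝ) < k := by linarith
      exact_mod_cast this
    omega

/-- Suppose `u` on the torus lifts to a function vanishing exactly where the phase
`a * x - ψ y` is a half-integer, `ψ` being continuous and increasing by `b` over a period.
Then `u` has `gcd a b` nodal domains. -/
theorem natCard_nodalDomains_of_phase {a b : ℤ} (ha : a ≠ 0) {ψ : ℝ → ℝ} (hψ : Continuous ψ)
    (hper : ∀ (y : ℝ) (t : ℤ), ψ (y + t) = ψ y + b * t)
    (u : AddCircle (1 : ℝ) × AddCircle (1 : ℝ) → ℝ)
    (hu : ∀ x y : ℝ, u ((x : AddCircle (1 : ℝ)), (y : AddCircle (1 : ℝ))) ≠ 0 ↔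
      cos (π * (a * x - ψ y)) ≠ 0) :
    Nat.card (ConnectedComponents
      {z : AddCircle (1 : ℝ) × AddCircle (1 : ℝ) // u z ≠ 0}) = Int.gcd a b := by
  have haR : (a : ℝ) ≠ 0 := Int.cast_ne_zero.2 ha
  set p : ℝ × ℝ → AddCircle (1 : ℝ) × AddCircle (1 : ℝ) :=
    Prod.map (fun x : ℝ => (x : AddCircle (1 : ℝ))) (fun y : ℝ => (y : AddCircle (1 : ℝ))) with hp
  have hpc : Continuous p :=
    (AddCircle.continuous_mk' 1).prodMap (AddCircle.continuous_mk' 1)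
  have hpo : IsOpenMap p :=
    QuotientAddGroup.isOpenMap_coe.prodMap QuotientAddGroup.isOpenMap_coe
  set D : ℤ → Set (ℝ × ℝ) := fun k =>
    {v | (k : ℝ) - 1 / 2 < a * v.1 - ψ v.2 ∧ a * v.1 - ψ v.2 < k + 1 / 2} with hD
  have hDo : ∀ k, IsOpen (D k) := by
    intro k
    have hc : Continuous fun v : ℝ × ℝ => a * v.1 - ψ v.2 := by fun_prop
    exact (isOpen_lt continuous_const hc).inter (isOpen_lt hc continuous_const)
  have hDc : ∀ k, IsConnected (D k) := by
    intro k
    have e : D k = (fun v : ℝ × ℝ => ((v.1 + ψ v.2) / a, v.2)) ''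
        (Set.Ioo ((k : ℝ) - 1 / 2) (k + 1 / 2) ×ˢ Set.univ) := by
      ext ⟨x, y⟩
      constructor
      · rintro h
        exact ⟨(a * x - ψ y, y), ⟨h, trivial⟩, by simp [haR]⟩
      · rintro ⟨⟨s, t⟩, ⟨h, -⟩, e⟩
        simp only [Prod.mk.injEq] at e
        obtain ⟨rfl, rfl⟩ := e
        simp only [hD, Set.mem_ofPred_eq]
        rw [mul_div_cancel₀ _ haR, add_sub_cancel_right]
        exact h
    rw [e]
    exact ((isConnected_Ioo (by linarith)).prod isConnected_univ).image _
      (by fun_prop)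
  have hDdisj : ∀ k l v, v ∈ D k → v ∈ D l → k = l := by
    intro k l v h1 h2
    have h3 : (k : ℝ) < l + 1 := by linarith [h1.1, h2.2]
    have h4 : (l : ℝ) < k + 1 := by linarith [h2.1, h1.2]
    have h5 : k < l + 1 := by exact_mod_cast h3
    have h6 : l < k + 1 := by exact_mod_cast h4
    omega
  have hDshift : ∀ k x y (s t : ℤ), (x, y) ∈ D k →
      (x + s, y + t) ∈ D (k + a * s - b * t) := by
    intro k x y s t h
    simp only [hD, Set.mem_ofPred_eq, hper] at h ⊢
    push_cast
    constructor <;> linarith [h.1, h.2]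
  have hpshift : ∀ x y (s t : ℤ), p (x + s, y + t) = p (x, y) := by
    intro x y s t
    simp [hp]
  have hpeq : ∀ x y x' y', p (x, y) = p (x', y') →
      ∃ s t : ℤ, x' = x + s ∧ y' = y + t := by
    intro x y x' y' h
    have key : ∀ x x' : ℝ, (x : AddCircle (1 : ℝ)) = x' → ∃ s : ℤ, x' = x + s := by
      intro x x' h
      obtain ⟨s, hs⟩ := (AddCircle.coe_eq_zero_iff (1 : ℝ) (x := x' - x)).1 (by simp [h])
      exact ⟨s, by linarith [zsmul_one (R := ℝ) s]⟩
    obtain ⟨s, hs⟩ := key _ _ (congrArg Prod.fst h)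
    obtain ⟨t, ht⟩ := key _ _ (congrArg Prod.snd h)
    exact ⟨s, t, hs, ht⟩
  have hmem : ∀ z, u z ≠ 0 → ∃ k : ℤ, z ∈ p '' D k := by
    rintro ⟨x, y⟩ h
    induction x using QuotientAddGroup.induction_on with | H x =>
    induction y using QuotientAddGroup.induction_on with | H y =>
    obtain ⟨k, hk⟩ := (cos_pi_mul_ne_zero_iff _).1 ((hu x y).1 h)
    exact ⟨k, (x, y), hk, rfl⟩
  have hne : ∀ k, ∀ z ∈ p '' D k, u z ≠ 0 := by
    rintro k _ ⟨⟨x, y⟩, h, rfl⟩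
    exact (hu x y).2 ((cos_pi_mul_ne_zero_iff _).2 ⟨k, h⟩)
  have hcast : ∀ k l : ℤ, (k : ZMod (Int.gcd a b)) = l ↔ ∃ s t : ℤ, l = k + a * s - b * t := by
    intro k l
    rw [ZMod.intCast_eq_intCast_iff_dvd_sub, Int.coe_gcd, gcd_dvd_iff_exists]
    constructor
    · rintro ⟨s, t, e⟩
      exact ⟨s, -t, by linarith⟩
    · rintro ⟨s, t, e⟩
      exact ⟨s, -t, by linarith⟩
  choose κ hκ using fun z : {z // u z ≠ 0} => hmem z z.2
  have hfib : ∀ k : ℤ, (fun z => (κ z : ZMod (Int.gcd a b))) ⁻¹' {(k : ZMod (Int.gcd a b))} =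
      Subtype.val ⁻¹' (p '' D k) := by
    intro k
    ext z
    obtain ⟨⟨x, y⟩, hv, hz⟩ := hκ z
    simp only [Set.mem_preimage, Set.mem_singleton_iff, hcast]
    constructor
    · rintro ⟨s, t, rfl⟩
      exact ⟨_, hDshift _ _ _ s t hv, by rw [hpshift, hz]⟩
    · rintro ⟨⟨x', y'⟩, hv', hz'⟩
      obtain ⟨s, t, rfl, rfl⟩ := hpeq _ _ _ _ (hz.trans hz'.symm)
      exact ⟨s, t, hDdisj _ _ _ hv' (hDshift _ _ _ s t hv)⟩
  rw [natCard_connectedComponents_eq_of_isConnected_fiber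
    (fun z => (κ z : ZMod (Int.gcd a b))), Nat.card_zmod]
  · intro j
    obtain ⟨k, rfl⟩ := ZMod.intCast_surjective j
    rw [hfib]
    exact (hpo _ (hDo k)).preimage continuous_subtype_val
  · intro j
    obtain ⟨k, rfl⟩ := ZMod.intCast_surjective j
    have hc := (hDc k).image p hpc.continuousOn
    have himage : Subtype.val '' (Subtype.val ⁻¹' (p '' D k) : Set {z // u z ≠ 0}) = p '' D k :=
      Set.image_preimage_eq_of_subset fun z hz => ⟨⟨z, hne k z hz⟩, rfl⟩
    rw [hfib]
    rw [← himage] at hc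
    exact ⟨hc.nonempty.of_image, Topology.IsInducing.subtypeVal.isPreconnected_image.1
      hc.isPreconnected⟩

/-- Let `m, n ≥ 1`, `λ ≠ 0` and `cos θ ≠ 0`. The function on the torus
`(ℝ/ℤ)²` given by `u(x,y) = cos(2πmx)cos(2πny + θ) + λ sin(2πmx)sin(2πny)` has exactly
`2·gcd(m,n)` nodal domains (connected components of `{u ≠ 0}`). -/
theorem statement9 (m n : ℕ) (hm : 1 ≤ m) (hn : 1 ≤ n) (lam θ : ℝ)
    (hlam : lam ≠ 0) (hθ : Real.cos θ ≠ 0)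
    (u : AddCircle (1 : ℝ) × AddCircle (1 : ℝ) → ℝ)
    (hu : ∀ x y : ℝ, u ((x : AddCircle (1 : ℝ)), (y : AddCircle (1 : ℝ))) =
      Real.cos (2 * π * m * x) * Real.cos (2 * π * n * y + θ)
        + lam * Real.sin (2 * π * m * x) * Real.sin (2 * π * n * y)) :
    Nat.card (ConnectedComponents
      {z : AddCircle (1 : ℝ) × AddCircle (1 : ℝ) // u z ≠ 0}) = 2 * Nat.gcd m n := by
  obtain ⟨φ, w, hφ, hw, hper, hpol⟩ := exists_continuous_polar hlam hθ
  have hperInt : ∀ (b : ℝ) (t : ℤ), φ (b + 2 * π * t) = φ b + 2 * π * w * t := by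
    have hg : Function.Periodic (fun b => φ b - w * b) (2 * π) := fun b => by
      simp only [hper]
      ring
    intro b t
    have := (hg.int_mul t) b
    rw [mul_comm (2 * π) (t : ℝ)]
    linarith
  rw [natCard_nodalDomains_of_phase (a := 2 * m) (b := 2 * n * w)
    (ψ := fun y => φ (2 * π * n * y) / π) (by omega) (by fun_prop) _ u]
  · have : Int.gcd (2 * m) (2 * n * w) = Int.gcd (2 * m) (2 * n) := by
      rcases hw with rfl | rfl <;> simp
    rw [this, Int.gcd_mul_left]
    rfl
  · intro x y
    obtain ⟨r, hr, hc, hs⟩ := hpol (2 * π * n * y)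
    have : u (x, y) = r * cos (π * (((2 * m : ℤ) : ℝ) * x - φ (2 * π * n * y) / π)) := by
      have e : π * (((2 * m : ℤ) : ℝ) * x - φ (2 * π * n * y) / π) =
          2 * π * m * x - φ (2 * π * n * y) := by
        have := pi_pos.ne'
        push_cast
        field_simp
      rw [e, cos_sub, hu, hc]
      linear_combination sin (2 * π * m * x) * hs
    rw [this, mul_ne_zero_iff]
    exact and_iff_right hr.ne'
  · intro y t
    have := hperInt (2 * π * n * y) (n * t)
    push_cast at this ⊢
    rw [show 2 * π * n * (y + t) = 2 * π * n * y + 2 * π * (n * t) by ring, this]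
    have := pi_pos.ne'
    field_simp
end

section
/- Let b > 0, let m, n ≥ 1 be integers, and let μ ≠ 0 and λ, θ₁, θ₂ ∈ ℝ. Consider on the torus T(1,b) = (ℝ/ℤ)×(ℝ/bℤ) the function u(x,y) = μ·(cos(2πmx)·cos(2πny/b + θ₁) + λ·sin(2πmx)·cos(2πny/b + θ₂)). Then u has at most 4mn nodal domains. Moreover, u has exactly 4mn nodal domains if and only if u is of the product form c·cos(2πmx + φ)·cos(2πny/b + ψ) for some constants c ≠ 0, φ, ψ; in all other cases u has exactly 2·gcd(m,n) nodal domains. -/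
open Real

/-- A set partitioned into connected open sets has exactly these as its connected components. -/
theorem nonempty_connectedComponents_equiv {X ι : Type*} [TopologicalSpace X] (s : Set X)
    (W : ι → Set X) (hopen : ∀ i, IsOpen (W i)) (hconn : ∀ i, IsConnected (W i))
    (hdisj : ∀ i j z, z ∈ W i → z ∈ W j → i = j) (hunion : ∀ z, z ∈ s ↔ ∃ i, z ∈ W i) :
    Nonempty (ConnectedComponents s ≃ ι) := by
  choose r hr using fun i => (hconn i).nonempty
  have hrs : ∀ i, r i ∈ s := fun i => (hunion _).2 ⟨i, hr i⟩
  refine ⟨(Equiv.ofBijective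
    (fun i => (ConnectedComponents.mk (⟨r i, hrs i⟩ : s))) ⟨?_, ?_⟩).symm⟩
  · intro i j hij
    have hclopen : IsClopen ((↑) ⁻¹' W i : Set s) := by
      refine ⟨⟨?_⟩, (hopen i).preimage continuous_subtype_val⟩
      have : ((↑) ⁻¹' W i : Set s)ᶜ = ⋃ j ∈ {j | j ≠ i}, ((↑) ⁻¹' W j : Set s) := by
        ext z
        simp only [Set.mem_compl_iff, Set.mem_preimage, Set.mem_iUnion, Set.mem_ofPred_eq,
          exists_prop]
        constructor
        · intro hz
          obtain ⟨j, hj⟩ := (hunion _).1 z.2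
          exact ⟨j, fun h => hz (h ▸ hj), hj⟩
        · rintro ⟨j, hne, hj⟩ hz
          exact hne (hdisj _ _ _ hj hz)
      rw [this]
      exact isOpen_biUnion fun j _ => (hopen j).preimage continuous_subtype_val
    have hsub := hclopen.connectedComponent_subset (x := ⟨r i, hrs i⟩) (hr i)
    have hmem : (⟨r j, hrs j⟩ : s) ∈ connectedComponent (⟨r i, hrs i⟩ : s) := by
      rw [ConnectedComponents.coe_eq_coe.1 hij]
      exact mem_connectedComponent
    exact hdisj _ _ _ (hsub hmem) (hr j)
  · intro c
    obtain ⟨z, rfl⟩ := ConnectedComponents.surjective_coe c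
    obtain ⟨i, hi⟩ := (hunion _).1 z.2
    refine ⟨i, ?_⟩
    have hWs : W i ⊆ s := fun z hz => (hunion z).2 ⟨i, hz⟩
    have hpre : IsPreconnected ((↑) ⁻¹' W i : Set s) := by
      rw [← Topology.IsInducing.subtypeVal.isPreconnected_image, Subtype.image_preimage_coe,
        Set.inter_eq_right.2 hWs]
      exact (hconn i).isPreconnected
    exact (ConnectedComponents.coe_eq_coe'.2
      (hpre.subset_connectedComponent (x := z) hi (hr i)))

/-- The connected components of a subset of a torus, described by connected open sets in the
plane whose images partition it. -/
theorem nonempty_connectedComponents_torus_equiv {ι : Type*} {a b : ℝ}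
    (s : Set (AddCircle a × AddCircle b)) (S : ι → Set (ℝ × ℝ))
    (hopen : ∀ i, IsOpen (S i)) (hconn : ∀ i, IsConnected (S i))
    (hdisj : ∀ i j (x y : ℝ) (k l : ℤ), (x, y) ∈ S i → (x + k * a, y + l * b) ∈ S j → i = j)
    (hsub : ∀ i (x y : ℝ), (x, y) ∈ S i → ((x : AddCircle a), (y : AddCircle b)) ∈ s)
    (hcover : ∀ x y : ℝ, ((x : AddCircle a), (y : AddCircle b)) ∈ s →
      ∃ i, ∃ k l : ℤ, (x + k * a, y + l * b) ∈ S i) :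
    Nonempty (ConnectedComponents s ≃ ι) := by
  set p : ℝ × ℝ → AddCircle a × AddCircle b :=
    Prod.map (fun x => (x : AddCircle a)) (fun y => (y : AddCircle b))
  have hpo : IsOpenMap p := QuotientAddGroup.isOpenMap_coe.prodMap QuotientAddGroup.isOpenMap_coe
  have hpc : Continuous p := (AddCircle.continuous_mk' a).prodMap (AddCircle.continuous_mk' b)
  have hlift : ∀ (c x x' : ℝ), (x : AddCircle c) = x' → ∃ k : ℤ, x' = x + k * c := by
    intro c x x' h
    rw [eq_comm, ← sub_eq_zero, ← AddCircle.coe_sub, AddCircle.coe_eq_zero_iff] at h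
    obtain ⟨k, hk⟩ := h
    refine ⟨k, ?_⟩
    rw [zsmul_eq_mul] at hk
    linarith
  have hper : ∀ (c x : ℝ) (k : ℤ), ((x + k * c : ℝ) : AddCircle c) = x := by
    intro c x k
    rw [AddCircle.coe_add, add_eq_left, AddCircle.coe_eq_zero_iff]
    exact ⟨k, zsmul_eq_mul _ _⟩
  refine nonempty_connectedComponents_equiv s (fun i => p '' S i) (fun i => hpo _ (hopen i))
    (fun i => (hconn i).image _ hpc.continuousOn) ?_ ?_
  · rintro i j _ ⟨⟨x, y⟩, hxy, rfl⟩ ⟨⟨x', y'⟩, hxy', h⟩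
    obtain ⟨k, rfl⟩ := hlift a x x' (congrArg Prod.fst h).symm
    obtain ⟨l, rfl⟩ := hlift b y y' (congrArg Prod.snd h).symm
    exact hdisj i j x y k l hxy hxy'
  · rintro ⟨z, w⟩
    obtain ⟨x, rfl⟩ := QuotientAddGroup.mk_surjective z
    obtain ⟨y, rfl⟩ := QuotientAddGroup.mk_surjective w
    constructor
    · intro h
      obtain ⟨i, k, l, hi⟩ := hcover x y h
      exact ⟨i, _, hi, Prod.ext (hper a x k) (hper b y l)⟩
    · rintro ⟨i, ⟨x', y'⟩, hi, h⟩
      rw [← h]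
      exact hsub i x' y' hi

theorem cos_ne_zero_iff_exists_abs_sub_lt (t : ℝ) :
    Real.cos t ≠ 0 ↔ ∃ k : ℤ, |t - k * π| < π / 2 := by
  have hπ := Real.pi_pos
  constructor
  · intro h
    refine ⟨⌊(t + π / 2) / π⌋, ?_⟩
    have h1 := Int.floor_le ((t + π / 2) / π)
    have h2 := Int.lt_floor_add_one ((t + π / 2) / π)
    rw [le_div_iff₀ hπ] at h1
    rw [div_lt_iff₀ hπ] at h2
    rw [abs_lt]
    refine ⟨lt_of_le_of_ne (by linarith) fun he => h ?_, by linarith⟩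
    rw [Real.cos_eq_zero_iff]
    refine ⟨⌊(t + π / 2) / π⌋ - 1, ?_⟩
    push_cast
    linarith
  · rintro ⟨k, hk⟩ h0
    rw [abs_lt] at hk
    have h := Real.cos_pos_of_mem_Ioo hk
    rw [Real.cos_sub_int_mul_pi, h0, mul_zero] at h
    exact lt_irrefl _ h

theorem eq_of_abs_sub_mul_pi_lt {t : ℝ} {i j : ℤ} (hi : |t - i * π| < π / 2)
    (hj : |t - j * π| < π / 2) : i = j := by
  have hπ := Real.pi_pos
  rw [abs_lt] at hi hj
  have h1 : ((i - j : ℤ) : ℝ) * π < (1 : ℤ) * π := by push_cast; linarith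
  have h2 : ((j - i : ℤ) : ℝ) * π < (1 : ℤ) * π := by push_cast; linarith
  have h1' := Int.cast_lt.1 (lt_of_mul_lt_mul_right h1 hπ.le)
  have h2' := Int.cast_lt.1 (lt_of_mul_lt_mul_right h2 hπ.le)
  omega

theorem Fin.eq_of_intCast_dvd_sub {N : ℕ} {i j : Fin N}
    (h : (N : ℤ) ∣ ((i : ℕ) : ℤ) - ((j : ℕ) : ℤ)) : i = j := by
  have hi := i.2
  have hj := j.2
  have := Int.eq_zero_of_abs_lt_dvd h (by rw [abs_lt]; omega)
  exact Fin.ext (by omega)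

theorem Fin.exists_intCast_dvd_sub {N : ℕ} (hN : 0 < N) (k : ℤ) :
    ∃ i : Fin N, (N : ℤ) ∣ ((i : ℕ) : ℤ) - k := by
  have h0 := Int.emod_nonneg k (b := N) (by omega)
  have h1 := Int.emod_lt_of_pos k (b := N) (by omega)
  refine ⟨⟨(k % N).toNat, by omega⟩, ?_⟩
  simp only [Int.toNat_of_nonneg h0]
  exact (Int.mod_modEq k N).symm.dvd

/-- The continuous angle function along the ellipse `t ↦ α * exp (i t) + β * exp (-i t)`. -/
theorem exists_angle_of_norm_lt {α β : ℂ} (h : ‖β‖ < ‖α‖) :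
    ∃ Θ ρ : ℝ → ℝ, Continuous Θ ∧ (∀ t, Θ (t + 2 * π) = Θ t + 2 * π) ∧ (∀ t, 0 < ρ t) ∧
      ∀ t : ℝ, α * Complex.exp (t * Complex.I) + β * Complex.exp (-t * Complex.I) =
        ρ t * Complex.exp (Θ t * Complex.I) := by
  have hα : α ≠ 0 := norm_pos_iff.1 ((norm_nonneg β).trans_lt h)
  set v : ℝ → ℂ := fun t => 1 + β / α * Complex.exp (-(2 * t) * Complex.I) with hv
  have hre : ∀ t, 0 < (v t).re := by
    intro t
    have h1 : ‖β / α * Complex.exp (-(2 * t) * Complex.I)‖ < 1 := by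
      have : ‖Complex.exp (-(2 * t) * Complex.I)‖ = 1 := by
        have := Complex.norm_exp_ofReal_mul_I (-(2 * t))
        push_cast at this
        exact this
      rw [norm_mul, this, mul_one, norm_div, div_lt_one (norm_pos_iff.2 hα)]
      exact h
    have h3 := (abs_lt.1 ((Complex.abs_re_le_norm _).trans_lt h1)).1
    simp only [hv, Complex.add_re, Complex.one_re]
    linarith
  refine ⟨fun t => α.arg + t + (v t).arg, fun t => ‖α‖ * ‖v t‖, ?_, ?_, ?_, ?_⟩
  · refine (continuous_const.add continuous_id).add ?_
    have hvc : Continuous v := by fun_prop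
    exact continuous_iff_continuousAt.2 fun t =>
      (Complex.continuousAt_arg (Or.inl (hre t))).comp hvc.continuousAt
  · intro t
    have : v (t + 2 * π) = v t := by
      simp only [hv]
      congr 2
      rw [Complex.exp_eq_exp_iff_exists_int]
      refine ⟨-2, ?_⟩
      push_cast
      ring
    simp only [this]
    ring
  · intro t
    have : v t ≠ 0 := fun h0 => by simpa [h0] using hre t
    positivity
  · intro t
    have e1 := Complex.norm_mul_exp_arg_mul_I α
    have e2 := Complex.norm_mul_exp_arg_mul_I (v t)
    have e3 : Complex.exp (-t * Complex.I) =
        Complex.exp (-(2 * t) * Complex.I) * Complex.exp (t * Complex.I) := by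
      rw [← Complex.exp_add]
      congr 1
      ring
    have e4 : α * v t = α + β * Complex.exp (-(2 * t) * Complex.I) := by
      simp only [hv]
      field_simp
    calc _ = α * v t * Complex.exp (t * Complex.I) := by rw [e4, e3]; ring
      _ = (‖α‖ * Complex.exp (α.arg * Complex.I)) *
          (‖v t‖ * Complex.exp ((v t).arg * Complex.I)) * Complex.exp (t * Complex.I) := by
        rw [e1, e2]
      _ = _ := by
        push_cast
        rw [add_mul, add_mul, Complex.exp_add, Complex.exp_add]
        ring

/-- Polar coordinates along the ellipse `t ↦ (cos (t + θ₁), lam * cos (t + θ₂))`. -/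
theorem exists_angle_ellipse {lam θ₁ θ₂ : ℝ} (h : lam * Real.sin (θ₂ - θ₁) ≠ 0) :
    ∃ (ε : ℤ) (Θ ρ : ℝ → ℝ), ε * ε = 1 ∧ Continuous Θ ∧
      (∀ t, Θ (t + 2 * π) = Θ t + ε * (2 * π)) ∧ (∀ t, 0 < ρ t) ∧
      ∀ t, Real.cos (t + θ₁) = ρ t * Real.cos (Θ t) ∧
        lam * Real.cos (t + θ₂) = ρ t * Real.sin (Θ t) := by
  set α : ℂ := (Complex.exp (θ₁ * Complex.I) + lam * Complex.I * Complex.exp (θ₂ * Complex.I)) / 2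
    with hα
  set β : ℂ := (Complex.exp (-θ₁ * Complex.I) +
    lam * Complex.I * Complex.exp (-θ₂ * Complex.I)) / 2 with hβ
  have key : ∀ t : ℝ, α * Complex.exp (t * Complex.I) + β * Complex.exp (-t * Complex.I) =
      Real.cos (t + θ₁) + (lam * Real.cos (t + θ₂) : ℝ) * Complex.I := by
    intro t
    push_cast
    simp only [Complex.cos, hα, hβ, neg_mul, add_mul, neg_add, Complex.exp_add]
    ring
  have parts : ∀ {t r φ : ℝ}, α * Complex.exp (t * Complex.I) + β * Complex.exp (-t * Complex.I) =
      r * Complex.exp (φ * Complex.I) → Real.cos (t + θ₁) = r * Real.cos φ ∧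
        lam * Real.cos (t + θ₂) = r * Real.sin φ := by
    intro t r φ he
    rw [key, Complex.exp_mul_I, ← Complex.ofReal_cos, ← Complex.ofReal_sin] at he
    have h1 := congrArg Complex.re he
    have h2 := congrArg Complex.im he
    simp only [Complex.add_re, Complex.ofReal_re, Complex.mul_re, Complex.I_re, Complex.I_im,
      Complex.ofReal_im, Complex.add_im, Complex.mul_im] at h1 h2
    constructor <;> linarith
  have hne : ‖β‖ ≠ ‖α‖ := by
    intro he
    have h2 : Complex.normSq β = Complex.normSq α := by
      rw [Complex.normSq_eq_norm_sq, Complex.normSq_eq_norm_sq, he]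
    apply h
    rw [hα, hβ, ← Complex.ofReal_neg, ← Complex.ofReal_neg, Complex.exp_mul_I, Complex.exp_mul_I,
      Complex.exp_mul_I, Complex.exp_mul_I] at h2
    simp only [← Complex.ofReal_cos, ← Complex.ofReal_sin, map_div₀, Complex.normSq_apply,
      Complex.add_re, Complex.ofReal_re, Complex.mul_re, Complex.I_re, Complex.I_im,
      Complex.ofReal_im, Complex.add_im, Complex.mul_im, Real.cos_neg, Real.sin_neg,
      Complex.re_ofNat, Complex.im_ofNat] at h2
    rw [Real.sin_sub]
    linarith
  rcases lt_or_gt_of_ne hne with hlt | hlt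
  · obtain ⟨Θ, ρ, hc, hp, hρ, he⟩ := exists_angle_of_norm_lt hlt
    exact ⟨1, Θ, ρ, rfl, hc, fun t => by rw [hp]; push_cast; ring, hρ, fun t => parts (he t)⟩
  · obtain ⟨Θ, ρ, hc, hp, hρ, he⟩ := exists_angle_of_norm_lt hlt
    refine ⟨-1, fun t => Θ (-t), fun t => ρ (-t), rfl, hc.comp continuous_neg, fun t => ?_,
      fun t => hρ _, fun t => parts ?_⟩
    · have := hp (-(t + 2 * π))
      rw [show -(t + 2 * π) + 2 * π = -t by ring] at this
      push_cast
      linarith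
    · have := he (-t)
      rw [← this]
      push_cast
      rw [neg_neg]
      ring

theorem isConnected_abs_sub_lt {c : ℝ} (hc : c ≠ 0) (f : ℝ → ℝ) (hf : Continuous f) (k : ℝ) :
    IsConnected {p : ℝ × ℝ | |c * p.1 - f p.2 - k * π| < π / 2} := by
  have hI : IsConnected (Set.Ioo (-(π / 2)) (π / 2) ×ˢ (Set.univ : Set ℝ)) :=
    (isConnected_Ioo (by linarith [Real.pi_pos])).prod isConnected_univ
  have hg : Continuous fun q : ℝ × ℝ => ((q.1 + f q.2 + k * π) / c, q.2) := by fun_prop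
  convert hI.image _ hg.continuousOn using 1
  ext ⟨x, y⟩
  simp only [Set.mem_ofPred_eq, Set.mem_image, Set.mem_prod, Set.mem_Ioo, Set.mem_univ, and_true,
    Prod.exists, Prod.mk.injEq, abs_lt]
  constructor
  · intro h
    refine ⟨c * x - f y - k * π, y, h, ?_, rfl⟩
    field_simp
    ring
  · rintro ⟨s, y', h, rfl, rfl⟩
    have e : c * ((s + f y' + k * π) / c) - f y' - k * π = s := by
      field_simp
      ring
    rwa [e]

/-- Nodal domains of `ρ (y) * cos (2πmx - Θ (2πny/b))`. -/
theorem nonempty_connectedComponents_equiv_of_angle {b : ℝ} (hb : 0 < b) {m n : ℕ} (hm : 1 ≤ m)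
    {u : AddCircle (1 : ℝ) × AddCircle b → ℝ} {ε : ℤ} (hε : ε * ε = 1) {Θ : ℝ → ℝ}
    (hΘ : Continuous Θ) (hper : ∀ t, Θ (t + 2 * π) = Θ t + ε * (2 * π))
    (hu : ∀ x y : ℝ, u ((x : AddCircle (1 : ℝ)), (y : AddCircle b)) ≠ 0 ↔
      Real.cos (2 * π * m * x - Θ (2 * π * n * y / b)) ≠ 0) :
    Nonempty (ConnectedComponents {z : AddCircle (1 : ℝ) × AddCircle b // u z ≠ 0} ≃
      Fin (2 * Nat.gcd m n)) := by
  have hπ := Real.pi_pos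
  have hm0 : (m : ℝ) ≠ 0 := by positivity
  have hg : 0 < Nat.gcd m n := Nat.gcd_pos_of_pos_left _ hm
  have hperZ : ∀ (l : ℤ) (t : ℝ), Θ (t + l * (2 * π)) = Θ t + l * (ε * (2 * π)) := by
    intro l t
    have hp : Function.Periodic (fun t => Θ t - ε * t) (2 * π) := fun s => by
      simp only [hper]
      ring
    have := hp.int_mul l t
    linarith
  have hshift : ∀ (x y : ℝ) (k l : ℤ),
      2 * π * m * (x + k * 1) - Θ (2 * π * n * (y + l * b) / b) =
        2 * π * m * x - Θ (2 * π * n * y / b) + (2 * (m * k - ε * n * l) : ℤ) * π := by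
    intro x y k l
    have : 2 * π * n * (y + l * b) / b = 2 * π * n * y / b + (n * l : ℤ) * (2 * π) := by
      push_cast
      field_simp
    rw [this, hperZ]
    push_cast
    ring
  refine nonempty_connectedComponents_torus_equiv {z | u z ≠ 0}
    (fun i : Fin (2 * Nat.gcd m n) => {p : ℝ × ℝ |
      |2 * π * m * p.1 - Θ (2 * π * n * p.2 / b) - (((i : ℕ) : ℤ) : ℝ) * π| < π / 2})
    (fun i => ?_) (fun i => ?_) ?_ ?_ ?_
  · exact isOpen_lt (by fun_prop) continuous_const
  · exact isConnected_abs_sub_lt (c := 2 * π * m) (by positivity)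
      (fun y => Θ (2 * π * n * y / b)) (by fun_prop) _
  · intro i j x y k l hi hj
    simp only [Set.mem_ofPred_eq, hshift] at hi hj
    have hj' : |2 * π * m * x - Θ (2 * π * n * y / b) -
        ((((j : ℕ) : ℤ) - 2 * (m * k - ε * n * l) : ℤ) : ℝ) * π| < π / 2 := by
      convert hj using 2
      push_cast
      ring
    have hij := eq_of_abs_sub_mul_pi_lt hi hj'
    apply Fin.eq_of_intCast_dvd_sub
    have h1 : ((Nat.gcd m n : ℕ) : ℤ) ∣ m := Int.natCast_dvd_natCast.2 (Nat.gcd_dvd_left m n)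
    have h2 : ((Nat.gcd m n : ℕ) : ℤ) ∣ n := Int.natCast_dvd_natCast.2 (Nat.gcd_dvd_right m n)
    rw [show ((i : ℕ) : ℤ) - ((j : ℕ) : ℤ) = 2 * (-(m * k - ε * n * l)) by linarith]
    rw [Nat.cast_mul]
    exact mul_dvd_mul_left 2 (((h1.mul_right k).sub ((h2.mul_left ε).mul_right l)).neg_right)
  · intro i x y hi
    exact (hu x y).2 ((cos_ne_zero_iff_exists_abs_sub_lt _).2 ⟨_, hi⟩)
  · intro x y hxy
    obtain ⟨k, hk⟩ := (cos_ne_zero_iff_exists_abs_sub_lt _).1 ((hu x y).1 hxy)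
    obtain ⟨i, q, hq⟩ := Fin.exists_intCast_dvd_sub (N := 2 * Nat.gcd m n) (by omega) k
    have hbez := Nat.gcd_eq_gcd_ab m n
    refine ⟨i, Nat.gcdA m n * q, -(ε * Nat.gcdB m n * q), ?_⟩
    simp only [Set.mem_ofPred_eq, hshift]
    have e : ((i : ℕ) : ℤ) = k + 2 * (m * (Nat.gcdA m n * q) -
        ε * n * -(ε * Nat.gcdB m n * q)) := by
      rw [Nat.cast_mul, hbez] at hq
      push_cast at hq
      linear_combination hq - 2 * n * Nat.gcdB m n * q * hε
    rw [e]
    convert hk using 2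
    push_cast
    ring

/-- Nodal domains of `cos (2πmx + φ) * cos (2πny/b + ψ)`. -/
theorem nonempty_connectedComponents_equiv_of_product {b : ℝ} (hb : 0 < b) {m n : ℕ} (hm : 1 ≤ m)
    (hn : 1 ≤ n) {u : AddCircle (1 : ℝ) × AddCircle b → ℝ} {φ ψ : ℝ}
    (hu : ∀ x y : ℝ, u ((x : AddCircle (1 : ℝ)), (y : AddCircle b)) ≠ 0 ↔
      Real.cos (2 * π * m * x + φ) ≠ 0 ∧ Real.cos (2 * π * n * y / b + ψ) ≠ 0) :
    Nonempty (ConnectedComponents {z : AddCircle (1 : ℝ) × AddCircle b // u z ≠ 0} ≃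
      Fin (2 * m) × Fin (2 * n)) := by
  have hπ := Real.pi_pos
  have key : ∀ {a c : ℝ} {N : ℕ}, 0 < a → 1 ≤ N → ∃ S : Fin (2 * N) → Set ℝ,
      (∀ i, IsOpen (S i)) ∧ (∀ i, IsConnected (S i)) ∧
      (∀ i j (x : ℝ) (k : ℤ), x ∈ S i → x + k * a ∈ S j → i = j) ∧
      (∀ i x, x ∈ S i → Real.cos (2 * π * N * x / a + c) ≠ 0) ∧
      (∀ x, Real.cos (2 * π * N * x / a + c) ≠ 0 → ∃ i, ∃ k : ℤ, x + k * a ∈ S i) := by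
    intro a c N ha hN
    have hshift : ∀ (x : ℝ) (k : ℤ), 2 * π * N * (x + k * a) / a + c =
        2 * π * N * x / a + c + (2 * N * k : ℤ) * π := by
      intro x k
      push_cast
      field_simp
      ring
    have hN0 : (0 : ℝ) < N := by positivity
    refine ⟨fun i => {x | |2 * π * N * x / a + c - (((i : ℕ) : ℤ) : ℝ) * π| < π / 2},
      fun i => isOpen_lt (by fun_prop) continuous_const, fun i => ?_, ?_, ?_, ?_⟩
    · have hI : IsConnected (Set.Ioo (-(π / 2)) (π / 2)) :=
        isConnected_Ioo (by linarith)
      have hg : Continuous fun s : ℝ => (s - c + (((i : ℕ) : ℤ) : ℝ) * π) * a / (2 * π * N) := by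
        fun_prop
      convert hI.image _ hg.continuousOn using 1
      ext x
      simp only [Set.mem_ofPred_eq, Set.mem_image, Set.mem_Ioo, abs_lt]
      constructor
      · intro h
        refine ⟨_, h, ?_⟩
        field_simp
        ring
      · rintro ⟨s, h, rfl⟩
        have e : 2 * π * N * ((s - c + (((i : ℕ) : ℤ) : ℝ) * π) * a / (2 * π * N)) / a + c -
            (((i : ℕ) : ℤ) : ℝ) * π = s := by
          field_simp
          ring
        rwa [e]
    · intro i j x k hi hj
      simp only [Set.mem_ofPred_eq, hshift] at hi hj
      have hj' : |2 * π * N * x / a + c -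
          ((((j : ℕ) : ℤ) - 2 * N * k : ℤ) : ℝ) * π| < π / 2 := by
        convert hj using 2
        push_cast
        ring
      have hij := eq_of_abs_sub_mul_pi_lt hi hj'
      apply Fin.eq_of_intCast_dvd_sub
      refine ⟨-k, ?_⟩
      push_cast
      linarith
    · intro i x hi
      exact (cos_ne_zero_iff_exists_abs_sub_lt _).2 ⟨_, hi⟩
    · intro x hx
      obtain ⟨k, hk⟩ := (cos_ne_zero_iff_exists_abs_sub_lt _).1 hx
      obtain ⟨i, q, hq⟩ := Fin.exists_intCast_dvd_sub (N := 2 * N) (by omega) k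
      refine ⟨i, q, ?_⟩
      simp only [Set.mem_ofPred_eq, hshift]
      have e : ((i : ℕ) : ℤ) = k + 2 * N * q := by
        push_cast at hq
        linarith
      rw [e]
      convert hk using 2
      push_cast
      ring
  obtain ⟨S, hSo, hSc, hSd, hSs, hSe⟩ := key (c := φ) one_pos hm
  obtain ⟨S', hSo', hSc', hSd', hSs', hSe'⟩ := key (c := ψ) hb hn
  simp only [div_one] at hSs hSe
  refine nonempty_connectedComponents_torus_equiv {z | u z ≠ 0}
    (fun i : Fin (2 * m) × Fin (2 * n) => S i.1 ×ˢ S' i.2)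
    (fun i => (hSo _).prod (hSo' _)) (fun i => (hSc _).prod (hSc' _)) ?_ ?_ ?_
  · intro i j x y k l hi hj
    exact Prod.ext (hSd _ _ x k hi.1 hj.1) (hSd' _ _ y l hi.2 hj.2)
  · intro i x y hi
    exact (hu x y).2 ⟨hSs _ _ hi.1, hSs' _ _ hi.2⟩
  · intro x y hxy
    obtain ⟨h1, h2⟩ := (hu x y).1 hxy
    obtain ⟨i, k, hi⟩ := hSe x h1
    obtain ⟨j, l, hj⟩ := hSe' y h2
    exact ⟨(i, j), k, l, hi, hj⟩

/-- A degenerate ellipse gives a product of cosines. -/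
theorem exists_product_of_mul_sin_eq_zero {μ lam θ₁ θ₂ : ℝ} (hμ : μ ≠ 0)
    (h : lam * Real.sin (θ₂ - θ₁) = 0) :
    ∃ c φ : ℝ, c ≠ 0 ∧ ∀ s t : ℝ, μ * (Real.cos s * Real.cos (t + θ₁)
      + lam * Real.sin s * Real.cos (t + θ₂)) = c * Real.cos (s + φ) * Real.cos (t + θ₁) := by
  set w : ℂ := ⟨1, -(lam * Real.cos (θ₂ - θ₁))⟩ with hw
  have hw0 : w ≠ 0 := fun h0 => by simpa [hw] using congrArg Complex.re h0
  refine ⟨μ * ‖w‖, w.arg, mul_ne_zero hμ (norm_ne_zero_iff.2 hw0), fun s t => ?_⟩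
  have h1 : ‖w‖ * Real.cos w.arg = 1 := Complex.norm_mul_cos_arg w
  have h2 : ‖w‖ * Real.sin w.arg = -(lam * Real.cos (θ₂ - θ₁)) := Complex.norm_mul_sin_arg w
  rw [show t + θ₂ = (t + θ₁) + (θ₂ - θ₁) by ring, Real.cos_add (t + θ₁), Real.cos_add s]
  linear_combination (-(μ * Real.sin s * Real.sin (t + θ₁))) * h -
    μ * Real.cos s * Real.cos (t + θ₁) * h1 + μ * Real.sin s * Real.cos (t + θ₁) * h2

/-- Let `b > 0`, `m, n ≥ 1`, `μ ≠ 0` and `λ, θ₁, θ₂ ∈ ℝ`. Consider on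
the torus `T(1,b) = (ℝ/ℤ) × (ℝ/bℤ)` the function
`u(x,y) = μ(cos(2πmx)cos(2πny/b + θ₁) + λ sin(2πmx)cos(2πny/b + θ₂))`.
Then `u` has at most `4mn` nodal domains; it has exactly `4mn` nodal domains if and only
if it is of the product form `c·cos(2πmx + φ)·cos(2πny/b + ψ)` with `c ≠ 0`; and in all
other cases it has exactly `2·gcd(m,n)` nodal domains. -/
theorem statement11 (b : ℝ) (hb : 0 < b) (m n : ℕ) (hm : 1 ≤ m) (hn : 1 ≤ n)
    (μ lam θ₁ θ₂ : ℝ) (hμ : μ ≠ 0)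
    (u : AddCircle (1 : ℝ) × AddCircle b → ℝ)
    (hu : ∀ x y : ℝ, u ((x : AddCircle (1 : ℝ)), (y : AddCircle b)) =
      μ * (Real.cos (2 * π * m * x) * Real.cos (2 * π * n * y / b + θ₁)
        + lam * Real.sin (2 * π * m * x) * Real.cos (2 * π * n * y / b + θ₂))) :
    Finite (ConnectedComponents {z : AddCircle (1 : ℝ) × AddCircle b // u z ≠ 0}) ∧
    Nat.card (ConnectedComponents {z : AddCircle (1 : ℝ) × AddCircle b // u z ≠ 0})
      ≤ 4 * m * n ∧
    (Nat.card (ConnectedComponents {z : AddCircle (1 : ℝ) × AddCircle b // u z ≠ 0})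
        = 4 * m * n ↔
      ∃ c φ ψ : ℝ, c ≠ 0 ∧ ∀ x y : ℝ, u ((x : AddCircle (1 : ℝ)), (y : AddCircle b)) =
        c * Real.cos (2 * π * m * x + φ) * Real.cos (2 * π * n * y / b + ψ)) ∧
    ((¬ ∃ c φ ψ : ℝ, c ≠ 0 ∧ ∀ x y : ℝ, u ((x : AddCircle (1 : ℝ)), (y : AddCircle b)) =
        c * Real.cos (2 * π * m * x + φ) * Real.cos (2 * π * n * y / b + ψ)) →
      Nat.card (ConnectedComponents {z : AddCircle (1 : ℝ) × AddCircle b // u z ≠ 0})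
        = 2 * Nat.gcd m n) := by
  have hprod : (∃ c φ ψ : ℝ, c ≠ 0 ∧ ∀ x y : ℝ,
      u ((x : AddCircle (1 : ℝ)), (y : AddCircle b)) =
        c * Real.cos (2 * π * m * x + φ) * Real.cos (2 * π * n * y / b + ψ)) →
      Nonempty (ConnectedComponents {z : AddCircle (1 : ℝ) × AddCircle b // u z ≠ 0} ≃
        Fin (2 * m) × Fin (2 * n)) := by
    rintro ⟨c, φ, ψ, hc, h⟩
    refine nonempty_connectedComponents_equiv_of_product hb hm hn (φ := φ) (ψ := ψ) fun x y => ?_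
    rw [h, mul_ne_zero_iff, mul_ne_zero_iff]
    exact ⟨fun h => ⟨h.1.2, h.2⟩, fun h => ⟨⟨hc, h.1⟩, h.2⟩⟩
  have hnon : (¬ ∃ c φ ψ : ℝ, c ≠ 0 ∧ ∀ x y : ℝ,
      u ((x : AddCircle (1 : ℝ)), (y : AddCircle b)) =
        c * Real.cos (2 * π * m * x + φ) * Real.cos (2 * π * n * y / b + ψ)) →
      Nonempty (ConnectedComponents {z : AddCircle (1 : ℝ) × AddCircle b // u z ≠ 0} ≃
        Fin (2 * Nat.gcd m n)) := by
    intro h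
    have hne : lam * Real.sin (θ₂ - θ₁) ≠ 0 := by
      intro h0
      obtain ⟨c, φ, hc, he⟩ := exists_product_of_mul_sin_eq_zero hμ h0
      exact h ⟨c, φ, θ₁, hc, fun x y => by rw [hu, he]⟩
    obtain ⟨ε, Θ, ρ, hε, hΘ, hper, hρ, he⟩ := exists_angle_ellipse hne
    refine nonempty_connectedComponents_equiv_of_angle hb hm hε hΘ hper fun x y => ?_
    obtain ⟨h1, h2⟩ := he (2 * π * n * y / b)
    have : u ((x : AddCircle (1 : ℝ)), (y : AddCircle b)) = μ * ρ (2 * π * n * y / b) *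
        Real.cos (2 * π * m * x - Θ (2 * π * n * y / b)) := by
      rw [hu, Real.cos_sub]
      linear_combination μ * Real.cos (2 * π * m * x) * h1 + μ * Real.sin (2 * π * m * x) * h2
    rw [this, mul_ne_zero_iff]
    exact and_iff_right (mul_ne_zero hμ (hρ _).ne')
  have hlt : 2 * Nat.gcd m n < 4 * m * n := by
    have := Nat.gcd_le_left n hm
    nlinarith
  by_cases hP : ∃ c φ ψ : ℝ, c ≠ 0 ∧ ∀ x y : ℝ,
      u ((x : AddCircle (1 : ℝ)), (y : AddCircle b)) =
        c * Real.cos (2 * π * m * x + φ) * Real.cos (2 * π * n * y / b + ψ)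
  · obtain ⟨e⟩ := hprod hP
    have hcard : Nat.card (ConnectedComponents
        {z : AddCircle (1 : ℝ) × AddCircle b // u z ≠ 0}) = 4 * m * n := by
      rw [Nat.card_congr e, Nat.card_prod, Nat.card_fin, Nat.card_fin]
      ring
    exact ⟨Finite.of_equiv _ e.symm, hcard.le, iff_of_true hcard hP, fun h => absurd hP h⟩
  · obtain ⟨e⟩ := hnon hP
    have hcard : Nat.card (ConnectedComponents
        {z : AddCircle (1 : ℝ) × AddCircle b // u z ≠ 0}) = 2 * Nat.gcd m n := by
      rw [Nat.card_congr e, Nat.card_fin]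
    exact ⟨Finite.of_equiv _ e.symm, hcard.trans_le hlt.le,
      iff_of_false (fun h => hlt.ne (hcard.symm.trans h)) hP, fun _ => hcard⟩
end

section
/- Let b > 0 with b² irrational, and let m, n ≥ 1 be integers. Then every smooth function u : ℝ² → ℝ that is periodic with periods (1,0) and (0,b) and satisfies Δu = −4π²(m² + n²/b²)·u (where Δu = ∂²u/∂x² + ∂²u/∂y²) is a linear combination of the four functions cos(2πmx)cos(2πny/b), cos(2πmx)sin(2πny/b), sin(2πmx)cos(2πny/b), and sin(2πmx)sin(2πny/b); i.e., the eigenvalue λ_{m,n} = 4π²(m² + n²/b²) of the Laplacian on T(1,b) has multiplicity exactly 4. -/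
open Real

noncomputable section

/-- The Laplacian `Δu = ∂²u/∂x² + ∂²u/∂y²` of `u : ℝ² → ℝ` at `p`. -/
def lap (u : ℝ × ℝ → ℝ) (p : ℝ × ℝ) : ℝ :=
  fderiv ℝ (fun q => fderiv ℝ u q (1, 0)) p (1, 0)
    + fderiv ℝ (fun q => fderiv ℝ u q (0, 1)) p (0, 1)

/-- The character `x ↦ exp (2πikx/T)` of `ℝ / Tℤ`, as a function on `ℝ`. -/
def torusChar (T : ℝ) (k : ℤ) (x : ℝ) : ℂ :=
  Complex.exp (2 * π * Complex.I * k * x / T)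

/-- The `k`-th Fourier coefficient of a `T`-periodic function on `ℝ`. -/
def torusCoeff (T : ℝ) (f : ℝ → ℂ) (k : ℤ) : ℂ :=
  (1 / T : ℂ) * ∫ x in (0 : ℝ)..T, torusChar T (-k) x * f x

lemma hasDerivAt_torusChar (T : ℝ) (k : ℤ) (x : ℝ) :
    HasDerivAt (torusChar T k) (2 * π * Complex.I * k / T * torusChar T k x) x := by
  have h : HasDerivAt (fun y : ℝ => 2 * π * Complex.I * k * (y : ℂ) / T)
      (2 * π * Complex.I * k * 1 / T) x :=
    ((hasDerivAt_id x).ofReal_comp.const_mul _).div_const _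
  refine h.cexp.congr_deriv ?_
  rw [torusChar]
  ring

@[fun_prop]
lemma continuous_torusChar (T : ℝ) (k : ℤ) : Continuous (torusChar T k) := by
  unfold torusChar
  fun_prop

lemma torusChar_zero (T : ℝ) (k : ℤ) : torusChar T k 0 = 1 := by
  simp [torusChar]

lemma torusChar_period {T : ℝ} (hT : T ≠ 0) (k : ℤ) : torusChar T k T = 1 := by
  have hT' : (T : ℂ) ≠ 0 := by exact_mod_cast hT
  rw [torusChar, mul_div_cancel_right₀ _ hT', ← Complex.exp_int_mul_two_pi_mul_I k]
  congr 1
  ring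

lemma integral_torusChar_mul_deriv_deriv {T : ℝ} (hT : T ≠ 0) (k : ℤ) {f f₁ f₂ : ℝ → ℂ}
    (hf : ∀ x, HasDerivAt f (f₁ x) x) (hf' : ∀ x, HasDerivAt f₁ (f₂ x) x)
    (hc : Continuous f₂) (hp : f T = f 0) (hp' : f₁ T = f₁ 0) :
    ∫ x in (0 : ℝ)..T, torusChar T k x * f₂ x
      = -(2 * π * k / T) ^ 2 * ∫ x in (0 : ℝ)..T, torusChar T k x * f x := by
  have hfc : Continuous f := continuous_iff_continuousAt.2 fun x => (hf x).continuousAt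
  have hd (x : ℝ) : HasDerivAt
      (fun x => torusChar T k x * f₁ x - 2 * π * Complex.I * k / T * torusChar T k x * f x)
      (torusChar T k x * f₂ x + (2 * π * k / T) ^ 2 * (torusChar T k x * f x)) x := by
    have h := hasDerivAt_torusChar T k x
    refine ((h.mul (hf' x)).sub ((h.const_mul (2 * π * Complex.I * k / T)).mul
      (hf x))).congr_deriv ?_
    linear_combination
      -((2 * π * k / T : ℂ) ^ 2 * torusChar T k x * f x) * Complex.I_sq
  have hi := intervalIntegral.integral_eq_sub_of_hasDerivAt (a := 0) (b := T)
    (fun x _ => hd x) (Continuous.intervalIntegrable (by fun_prop) _ _)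
  rw [intervalIntegral.integral_add (Continuous.intervalIntegrable (by fun_prop) _ _)
    (Continuous.intervalIntegrable (by fun_prop) _ _),
    intervalIntegral.integral_const_mul, hp, hp', torusChar_period hT, torusChar_zero,
    sub_self] at hi
  linear_combination hi

/-- A continuous periodic function whose Fourier coefficients vanish off a finite set is the
corresponding trigonometric polynomial. -/
lemma eq_sum_torusCoeff {T : ℝ} (hT : 0 < T) {f : ℝ → ℂ} (hf : Continuous f)
    (hp : Function.Periodic f T) (S : Finset ℤ) (hS : ∀ k ∉ S, torusCoeff T f k = 0) (x : ℝ) :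
    f x = ∑ k ∈ S, torusCoeff T f k * torusChar T k x := by
  have : Fact (0 < T) := ⟨hT⟩
  let F : C(AddCircle T, ℂ) := ⟨hp.lift, continuous_coinduced_dom.2 hf⟩
  have hF (k : ℤ) : fourierCoeff F k = torusCoeff T f k := by
    rw [fourierCoeff_eq_intervalIntegral _ _ 0, torusCoeff, zero_add, Complex.real_smul]
    push_cast
    congr 1
    refine intervalIntegral.integral_congr fun y _ => ?_
    change fourier (-k) (y : AddCircle T) • f y = _
    rw [fourier_coe_apply, smul_eq_mul, torusChar]
  have hS' : ∀ k ∉ S, fourierCoeff F k = 0 := fun k hk => (hF k).trans (hS k hk)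
  have h := has_pointwise_sum_fourier_series_of_summable
    (summable_of_ne_finset_zero (s := S) hS') (x : AddCircle T)
  have h' := h.unique (hasSum_sum_of_ne_finset_zero (s := S) fun k hk => by simp [hS' k hk])
  change f x = _ at h'
  rw [h']
  refine Finset.sum_congr rfl fun k _ => ?_
  rw [hF, smul_eq_mul, fourier_coe_apply, torusChar]

lemma int_eq_of_irrational_sq {b : ℝ} (hb : b ≠ 0) (hirr : Irrational (b ^ 2)) {k l m n : ℤ}
    (h : (k : ℝ) ^ 2 + (l : ℝ) ^ 2 / b ^ 2 = (m : ℝ) ^ 2 + (n : ℝ) ^ 2 / b ^ 2) :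
    k ∈ ({m, -m} : Finset ℤ) ∧ l ∈ ({n, -n} : Finset ℤ) := by
  have h1 : ((k ^ 2 - m ^ 2 : ℤ) : ℝ) * b ^ 2 = ((n ^ 2 - l ^ 2 : ℤ) : ℝ) := by
    field_simp at h
    push_cast
    linarith
  have hk : k ^ 2 - m ^ 2 = 0 := by
    by_contra hne
    exact (hirr.intCast_mul hne).ne_int _ h1
  rw [hk, Int.cast_zero, zero_mul, eq_comm, Int.cast_eq_zero] at h1
  simp only [Finset.mem_insert, Finset.mem_singleton]
  exact ⟨sq_eq_sq_iff_eq_or_eq_neg.1 (by linarith), sq_eq_sq_iff_eq_or_eq_neg.1 (by linarith)⟩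

lemma contDiff_fderiv_apply {E : Type*} [NormedAddCommGroup E] [NormedSpace ℝ E] {u : E → ℝ}
    (hu : ContDiff ℝ (⊤ : ℕ∞) u) (v : E) :
    ContDiff ℝ (⊤ : ℕ∞) (fun q => fderiv ℝ u q v) :=
  (hu.fderiv_right (by simp)).clm_apply contDiff_const

lemma fderiv_apply_periodic {E : Type*} [NormedAddCommGroup E] [NormedSpace ℝ E] {u : E → ℝ}
    {c : E} (h : ∀ p, u (p + c) = u p) (v p : E) :
    fderiv ℝ u (p + c) v = fderiv ℝ u p v := by
  rw [← fderiv_comp_add_right]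
  simp only [h]

lemma hasDerivAt_slice_fst {u : ℝ × ℝ → ℝ} (hu : ContDiff ℝ (⊤ : ℕ∞) u) (x y : ℝ) :
    HasDerivAt (fun x => (u (x, y) : ℂ)) (fderiv ℝ u (x, y) (1, 0) : ℝ) x :=
  HasDerivAt.ofReal_comp <|
    ((hu.differentiable (by simp)) (x, y)).hasFDerivAt.comp_hasDerivAt (f := fun x => (x, y)) x
      ((hasDerivAt_id x).prodMk (hasDerivAt_const x y))

lemma hasDerivAt_slice_snd {u : ℝ × ℝ → ℝ} (hu : ContDiff ℝ (⊤ : ℕ∞) u) (x y : ℝ) :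
    HasDerivAt (fun y => (u (x, y) : ℂ)) (fderiv ℝ u (x, y) (0, 1) : ℝ) y :=
  HasDerivAt.ofReal_comp <|
    ((hu.differentiable (by simp)) (x, y)).hasFDerivAt.comp_hasDerivAt (f := fun y => (x, y)) y
      ((hasDerivAt_const y x).prodMk (hasDerivAt_id y))

lemma integral_integral_torusChar_lap {S T : ℝ} (hS : S ≠ 0) (hT : T ≠ 0) {u : ℝ × ℝ → ℝ}
    (hu : ContDiff ℝ (⊤ : ℕ∞) u) (hper1 : ∀ p : ℝ × ℝ, u (p.1 + S, p.2) = u p)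
    (hper2 : ∀ p : ℝ × ℝ, u (p.1, p.2 + T) = u p) (k l : ℤ) :
    ∫ y in (0 : ℝ)..T, ∫ x in (0 : ℝ)..S,
        torusChar T l y * (torusChar S k x * (lap u (x, y) : ℂ))
      = -((2 * π * k / S) ^ 2 + (2 * π * l / T) ^ 2) * ∫ y in (0 : ℝ)..T, ∫ x in (0 : ℝ)..S,
        torusChar T l y * (torusChar S k x * (u (x, y) : ℂ)) := by
  have h1 : ∀ p, u (p + (S, 0)) = u p := fun p => by
    rw [← hper1 p]; congr 1; ext <;> simp
  have h2 : ∀ p, u (p + (0, T)) = u p := fun p => by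
    rw [← hper2 p]; congr 1; ext <;> simp
  have hx := contDiff_fderiv_apply hu (1, 0)
  have hy := contDiff_fderiv_apply hu (0, 1)
  have hxx := (contDiff_fderiv_apply hx (1, 0)).continuous
  have hyy := (contDiff_fderiv_apply hy (0, 1)).continuous
  have huc := hu.continuous
  have swap (g : ℝ × ℝ → ℝ) (hg : Continuous g) :
      ∫ y in (0 : ℝ)..T, ∫ x in (0 : ℝ)..S, torusChar T l y * (torusChar S k x * (g (x, y) : ℂ))
        = ∫ x in (0 : ℝ)..S, ∫ y in (0 : ℝ)..T,
          torusChar S k x * (torusChar T l y * (g (x, y) : ℂ)) := by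
    rw [MeasureTheory.intervalIntegral_intervalIntegral_swap]
    · simp only [mul_left_comm]
    · refine (Continuous.integrableOn_Icc (μ := MeasureTheory.volume) (a := (min 0 T, min 0 S))
        (b := (max 0 T, max 0 S)) (by unfold Function.uncurry; fun_prop)).mono_set ?_
      rw [← Set.Icc_prod_Icc]
      exact Set.prod_mono Set.uIoc_subset_uIcc Set.uIoc_subset_uIcc
  have key1 : ∫ y in (0 : ℝ)..T, ∫ x in (0 : ℝ)..S, torusChar T l y * (torusChar S k x *
      (fderiv ℝ (fun q => fderiv ℝ u q (1, 0)) (x, y) (1, 0) : ℂ))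
      = -(2 * π * k / S) ^ 2 * ∫ y in (0 : ℝ)..T, ∫ x in (0 : ℝ)..S,
        torusChar T l y * (torusChar S k x * (u (x, y) : ℂ)) := by
    rw [← intervalIntegral.integral_const_mul]
    refine intervalIntegral.integral_congr fun y _ => ?_
    simp only [intervalIntegral.integral_const_mul]
    rw [integral_torusChar_mul_deriv_deriv hS k (fun x => hasDerivAt_slice_fst hu x y)
      (fun x => hasDerivAt_slice_fst hx x y) (by fun_prop)
      (by simpa using h1 (0, y)) (by simpa using fderiv_apply_periodic h1 (1, 0) (0, y))]
    ring
  have key2 : ∫ y in (0 : ℝ)..T, ∫ x in (0 : ℝ)..S, torusChar T l y * (torusChar S k x *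
      (fderiv ℝ (fun q => fderiv ℝ u q (0, 1)) (x, y) (0, 1) : ℂ))
      = -(2 * π * l / T) ^ 2 * ∫ y in (0 : ℝ)..T, ∫ x in (0 : ℝ)..S,
        torusChar T l y * (torusChar S k x * (u (x, y) : ℂ)) := by
    rw [swap _ hyy, swap _ huc, ← intervalIntegral.integral_const_mul]
    refine intervalIntegral.integral_congr fun x _ => ?_
    simp only [intervalIntegral.integral_const_mul]
    rw [integral_torusChar_mul_deriv_deriv hT l (fun y => hasDerivAt_slice_snd hu x y)
      (fun y => hasDerivAt_slice_snd hy x y) (by fun_prop)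
      (by simpa using h2 (x, 0)) (by simpa using fderiv_apply_periodic h2 (0, 1) (x, 0))]
    ring
  have hint (g : ℝ × ℝ → ℝ) (hg : Continuous g) : Continuous fun y => ∫ x in (0 : ℝ)..S,
      torusChar T l y * (torusChar S k x * (g (x, y) : ℂ)) :=
    intervalIntegral.continuous_parametric_intervalIntegral_of_continuous' (by fun_prop) _ _
  rw [neg_add, add_mul, ← key1, ← key2, ← intervalIntegral.integral_add
    ((hint _ hxx).intervalIntegrable _ _) ((hint _ hyy).intervalIntegrable _ _)]
  refine intervalIntegral.integral_congr fun y _ => ?_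
  rw [← intervalIntegral.integral_add (Continuous.intervalIntegrable (by fun_prop) _ _)
    (Continuous.intervalIntegrable (by fun_prop) _ _)]
  refine intervalIntegral.integral_congr fun x _ => ?_
  simp only [lap]
  push_cast
  ring

/-- Let `b > 0` with `b²` irrational and `m, n ≥ 1`. Every smooth
function `u : ℝ² → ℝ` periodic with periods `(1,0)` and `(0,b)` satisfying
`Δu = -4π²(m² + n²/b²)·u` is a linear combination of the four functions
`cos(2πmx)cos(2πny/b)`, `cos(2πmx)sin(2πny/b)`, `sin(2πmx)cos(2πny/b)`,
`sin(2πmx)sin(2πny/b)`; i.e. the eigenvalue `λ_{m,n} = 4π²(m² + n²/b²)` of the Laplacian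
on `T(1,b)` has multiplicity exactly `4`. -/
theorem statement12 (b : ℝ) (hb : 0 < b) (hirr : Irrational (b ^ 2))
    (m n : ℕ) (hm : 1 ≤ m) (hn : 1 ≤ n)
    (u : ℝ × ℝ → ℝ) (hu : ContDiff ℝ (⊤ : ℕ∞) u)
    (hper1 : ∀ p : ℝ × ℝ, u (p.1 + 1, p.2) = u p)
    (hper2 : ∀ p : ℝ × ℝ, u (p.1, p.2 + b) = u p)
    (heig : ∀ p : ℝ × ℝ,
      lap u p = -(4 * π ^ 2 * ((m : ℝ) ^ 2 + (n : ℝ) ^ 2 / b ^ 2)) * u p) :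
    ∃ c₁ c₂ c₃ c₄ : ℝ, ∀ p : ℝ × ℝ,
      u p = c₁ * Real.cos (2 * π * m * p.1) * Real.cos (2 * π * n * p.2 / b)
          + c₂ * Real.cos (2 * π * m * p.1) * Real.sin (2 * π * n * p.2 / b)
          + c₃ * Real.sin (2 * π * m * p.1) * Real.cos (2 * π * n * p.2 / b)
          + c₄ * Real.sin (2 * π * m * p.1) * Real.sin (2 * π * n * p.2 / b) := by
  have hb0 := hb.ne'
  have huc := hu.continuous
  let a (k : ℤ) (y : ℝ) : ℂ := torusCoeff 1 (fun x => (u (x, y) : ℂ)) k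
  have ha (k : ℤ) : Continuous (a k) :=
    continuous_const.mul <|
      intervalIntegral.continuous_parametric_intervalIntegral_of_continuous' (by fun_prop) _ _
  have hap (k : ℤ) : Function.Periodic (a k) b := fun y => by
    simp only [a]
    congr 1
    ext x
    rw [hper2 (x, y)]
  have hcoeff (k l : ℤ) (hkl : ¬ (k ∈ ({(m : ℤ), -(m : ℤ)} : Finset ℤ) ∧
      l ∈ ({(n : ℤ), -(n : ℤ)} : Finset ℤ))) : torusCoeff b (a k) l = 0 := by
    have h := integral_integral_torusChar_lap one_ne_zero hb0 hu hper1 hper2 (-k) (-l)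
    have hpull : ∫ y in (0 : ℝ)..b, ∫ x in (0 : ℝ)..1,
        torusChar b (-l) y * (torusChar 1 (-k) x * (lap u (x, y) : ℂ))
        = ((-(4 * π ^ 2 * ((m : ℝ) ^ 2 + (n : ℝ) ^ 2 / b ^ 2)) : ℝ) : ℂ) *
          ∫ y in (0 : ℝ)..b, ∫ x in (0 : ℝ)..1,
            torusChar b (-l) y * (torusChar 1 (-k) x * (u (x, y) : ℂ)) := by
      simp only [← intervalIntegral.integral_const_mul, heig, Complex.ofReal_mul,
        mul_left_comm]
    rw [hpull] at h
    have hne : (k : ℝ) ^ 2 + (l : ℝ) ^ 2 / b ^ 2 - ((m : ℝ) ^ 2 + (n : ℝ) ^ 2 / b ^ 2) ≠ 0 :=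
      fun h0 => hkl <| int_eq_of_irrational_sq hb0 hirr (by push_cast; linarith)
    have hne' : ((4 * π ^ 2 * ((k : ℝ) ^ 2 + (l : ℝ) ^ 2 / b ^ 2
        - ((m : ℝ) ^ 2 + (n : ℝ) ^ 2 / b ^ 2)) : ℝ) : ℂ) ≠ 0 := by
      exact_mod_cast mul_ne_zero (by positivity) hne
    have h0 : ∫ y in (0 : ℝ)..b, ∫ x in (0 : ℝ)..1,
        torusChar b (-l) y * (torusChar 1 (-k) x * (u (x, y) : ℂ)) = 0 := by
      refine (mul_eq_zero.1 ?_).resolve_left hne'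
      push_cast at h ⊢
      linear_combination h
    simp only [intervalIntegral.integral_const_mul] at h0
    simp [a, torusCoeff, h0]
  have hzero (k : ℤ) (hk : k ∉ ({(m : ℤ), -(m : ℤ)} : Finset ℤ)) (y : ℝ) : a k y = 0 := by
    simpa using eq_sum_torusCoeff hb (ha k) (hap k) ∅
      (fun l _ => hcoeff k l fun h => hk h.1) y
  have hmm : (m : ℤ) ≠ -(m : ℤ) := by omega
  have hnn : (n : ℤ) ≠ -(n : ℤ) := by omega
  have hsum (x y : ℝ) : (u (x, y) : ℂ) = ∑ k ∈ ({(m : ℤ), -(m : ℤ)} : Finset ℤ),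
      (∑ l ∈ ({(n : ℤ), -(n : ℤ)} : Finset ℤ), torusCoeff b (a k) l * torusChar b l y)
        * torusChar 1 k x := by
    rw [eq_sum_torusCoeff one_pos (f := fun x => (u (x, y) : ℂ)) (by fun_prop)
      (fun x => by simp only [hper1 (x, y)]) _ (fun k hk => hzero k hk y) x]
    refine Finset.sum_congr rfl fun k _ => ?_
    rw [← eq_sum_torusCoeff hb (ha k) (hap k) _ (fun l hl => hcoeff k l fun h => hl h.2) y]
  have hchar (T : ℝ) (j : ℕ) (t : ℝ) :
      torusChar T j t = (Real.cos (2 * π * j * t / T) : ℂ)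
          + (Real.sin (2 * π * j * t / T) : ℂ) * Complex.I ∧
        torusChar T (-j) t = (Real.cos (2 * π * j * t / T) : ℂ)
          - (Real.sin (2 * π * j * t / T) : ℂ) * Complex.I := by
    simp only [torusChar]
    push_cast
    rw [← Complex.exp_mul_I, sub_eq_add_neg, ← neg_mul, ← Complex.cos_neg, ← Complex.sin_neg,
      ← Complex.exp_mul_I]
    constructor <;> congr 1 <;> ring
  set A := torusCoeff b (a m) n
  set B := torusCoeff b (a m) (-n)
  set C := torusCoeff b (a (-m)) n
  set D := torusCoeff b (a (-m)) (-n)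
  refine ⟨(A + B + C + D).re, ((A - B + C - D) * Complex.I).re,
    ((A + B - C - D) * Complex.I).re, (-(A - B - C + D)).re, fun ⟨x, y⟩ => ?_⟩
  have h := hsum x y
  rw [Finset.sum_pair hmm, Finset.sum_pair hnn, Finset.sum_pair hnn, (hchar 1 m x).1,
    (hchar 1 m x).2, (hchar b n y).1, (hchar b n y).2, div_one] at h
  have hre := congrArg Complex.re h
  simp only [Complex.ofReal_re, Complex.add_re, Complex.sub_re, Complex.mul_re, Complex.neg_re,
    Complex.add_im, Complex.sub_im, Complex.mul_im, Complex.ofReal_im, Complex.I_re,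
    Complex.I_im] at hre ⊢
  rw [hre]
  ring
end
end

section
/- Let p, q be integers, not both zero, with gcd(p,q) = 1. Then the set C = {(x,y) ∈ (ℝ/ℤ)² : qx − py ∈ ℤ} (the torus knot of winding numbers (p,q)) is connected, while its preimage under the four-fold covering map (ℝ/2ℤ)² → (ℝ/ℤ)², namely the set {(x,y) ∈ (ℝ/2ℤ)² : qx − py ∈ ℤ}, has exactly 2 connected components. -/
open Real

/-- A level set of the character `(x, y) ↦ q x - p y` on the torus `(ℝ/Tℤ)²` is connected when
`p` and `q` are coprime: it is a translate of the curve `t ↦ (p t, q t)`. -/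
theorem isConnected_setOf_zsmul_sub_zsmul_eq {p q : ℤ} (h : IsCoprime p q) (T c : ℝ) :
    IsConnected {z : AddCircle T × AddCircle T | q • z.1 - p • z.2 = (c : AddCircle T)} := by
  obtain ⟨u, v, huv⟩ := h
  have huv' : (u : ℝ) * p + v * q = 1 := by exact_mod_cast huv
  have hrange : {z : AddCircle T × AddCircle T | q • z.1 - p • z.2 = (c : AddCircle T)} =
      Set.range fun t : ℝ ↦ (((p * t + c * v : ℝ) : AddCircle T),
        ((q * t - c * u : ℝ) : AddCircle T)) := by
    ext ⟨x, y⟩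
    induction x using QuotientAddGroup.induction_on with | _ x
    induction y using QuotientAddGroup.induction_on with | _ y
    simp only [Set.mem_ofPred_eq, Set.mem_range, Prod.mk.injEq]
    constructor
    · intro hxy
      rw [← AddCircle.coe_zsmul, ← AddCircle.coe_zsmul, ← AddCircle.coe_sub, ← sub_eq_zero,
        ← AddCircle.coe_sub, AddCircle.coe_eq_zero_iff] at hxy
      obtain ⟨k, hk⟩ := hxy
      simp only [zsmul_eq_mul] at hk
      refine ⟨u * x + v * y, ?_, ?_⟩
      · rw [← sub_eq_zero, ← AddCircle.coe_sub, AddCircle.coe_eq_zero_iff]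
        refine ⟨-(k * v), ?_⟩
        simp only [zsmul_eq_mul]
        push_cast
        linear_combination (-(v : ℝ)) * hk - x * huv'
      · rw [← sub_eq_zero, ← AddCircle.coe_sub, AddCircle.coe_eq_zero_iff]
        refine ⟨k * u, ?_⟩
        simp only [zsmul_eq_mul]
        push_cast
        linear_combination (u : ℝ) * hk - y * huv'
    · rintro ⟨t, hx, hy⟩
      rw [← hx, ← hy, ← AddCircle.coe_zsmul, ← AddCircle.coe_zsmul, ← AddCircle.coe_sub]
      congr 1
      simp only [zsmul_eq_mul]
      linear_combination c * huv'
  rw [hrange]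
  refine isConnected_range (.prodMk ?_ ?_)
  · exact (AddCircle.continuous_mk' T).comp (by fun_prop)
  · exact (AddCircle.continuous_mk' T).comp (by fun_prop)

/-- A space that is the union of two disjoint closed connected subsets has exactly two connected
components. -/
theorem ConnectedComponents.natCard_eq_two {X : Type*} [TopologicalSpace X] {s : Set X}
    (hs : IsConnected s) (hs' : IsConnected sᶜ) (hcl : IsClosed s) (hcl' : IsClosed sᶜ) :
    Nat.card (ConnectedComponents X) = 2 := by
  classical
  have hg : Continuous fun x ↦ decide (x ∈ s) := by
    rw [continuous_bool_rng true]
    have hpre : (fun x ↦ decide (x ∈ s)) ⁻¹' {true} = s := by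
      ext x
      simp
    rw [hpre]
    exact ⟨hcl, isClosed_compl_iff.mp hcl'⟩
  have hbij : Function.Bijective hg.connectedComponentsLift := by
    constructor
    · intro a b hab
      obtain ⟨x, rfl⟩ := ConnectedComponents.surjective_coe a
      obtain ⟨y, rfl⟩ := ConnectedComponents.surjective_coe b
      simp only [Continuous.connectedComponentsLift_apply_coe, decide_eq_decide] at hab
      rw [ConnectedComponents.coe_eq_coe']
      by_cases hy : y ∈ s
      · exact hs.isPreconnected.subset_connectedComponent hy (hab.mpr hy)
      · exact hs'.isPreconnected.subset_connectedComponent hy (mt hab.mp hy)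
    · intro b
      obtain ⟨x, hx⟩ := hs.nonempty
      obtain ⟨y, hy⟩ := hs'.nonempty
      cases b
      · exact ⟨y, by simpa using hy⟩
      · exact ⟨x, by simpa using hx⟩
  rw [Nat.card_eq_of_bijective _ hbij, Nat.card_eq_fintype_card, Fintype.card_bool]

/-- Let `p, q` be integers, not both zero, with `gcd(p,q) = 1`. The torus
knot `C = {(x,y) ∈ (ℝ/ℤ)² : qx - py ∈ ℤ}` is connected, while its preimage under the
four-fold covering map `(ℝ/2ℤ)² → (ℝ/ℤ)²` (induced by the identity on `ℝ²`), namely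
`{(x,y) ∈ (ℝ/2ℤ)² : qx - py ∈ ℤ}`, has exactly `2` connected components. -/
theorem statement15 (p q : ℤ) (hpq : ¬ (p = 0 ∧ q = 0)) (hgcd : Int.gcd p q = 1) :
    IsConnected {z : AddCircle (1 : ℝ) × AddCircle (1 : ℝ) |
      ∃ x y : ℝ, ((x : AddCircle (1 : ℝ)), (y : AddCircle (1 : ℝ))) = z ∧
        ∃ N : ℤ, (q : ℝ) * x - (p : ℝ) * y = (N : ℝ)} ∧
    Nat.card (ConnectedComponents
      {z : AddCircle (2 : ℝ) × AddCircle (2 : ℝ) //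
        ∃ x y : ℝ, ((x : AddCircle (2 : ℝ)), (y : AddCircle (2 : ℝ))) = z ∧
          ∃ N : ℤ, (q : ℝ) * x - (p : ℝ) * y = (N : ℝ)}) = 2 := by
  have hco : IsCoprime p q := Int.isCoprime_iff_gcd_eq_one.mpr hgcd
  constructor
  · convert isConnected_setOf_zsmul_sub_zsmul_eq hco 1 0 using 1
    ext z
    constructor
    · rintro ⟨x, y, rfl, N, hN⟩
      simp only [Set.mem_ofPred_eq]
      rw [← AddCircle.coe_zsmul, ← AddCircle.coe_zsmul, ← AddCircle.coe_sub, AddCircle.coe_zero,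
        AddCircle.coe_eq_zero_iff]
      exact ⟨N, by simp [hN]⟩
    · obtain ⟨x, y⟩ := z
      induction x using QuotientAddGroup.induction_on with | _ x
      induction y using QuotientAddGroup.induction_on with | _ y
      intro hxy
      simp only [Set.mem_ofPred_eq] at hxy
      rw [← AddCircle.coe_zsmul, ← AddCircle.coe_zsmul, ← AddCircle.coe_sub, AddCircle.coe_zero,
        AddCircle.coe_eq_zero_iff] at hxy
      obtain ⟨N, hN⟩ := hxy
      exact ⟨x, y, rfl, N, by simpa using hN.symm⟩
  · have hmem : ∀ z : AddCircle (2 : ℝ) × AddCircle (2 : ℝ),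
        (∃ x y : ℝ, ((x : AddCircle (2 : ℝ)), (y : AddCircle (2 : ℝ))) = z ∧
          ∃ N : ℤ, (q : ℝ) * x - (p : ℝ) * y = (N : ℝ)) ↔
        q • z.1 - p • z.2 = ((0 : ℝ) : AddCircle (2 : ℝ)) ∨
          q • z.1 - p • z.2 = ((1 : ℝ) : AddCircle (2 : ℝ)) := by
      have hcoe : ∀ x y c : ℝ, q • (x : AddCircle (2 : ℝ)) - p • (y : AddCircle (2 : ℝ)) = c ↔
          ∃ k : ℤ, (q : ℝ) * x - p * y = c + k * 2 := by
        intro x y c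
        rw [← AddCircle.coe_zsmul, ← AddCircle.coe_zsmul, ← AddCircle.coe_sub, ← sub_eq_zero,
          ← AddCircle.coe_sub, AddCircle.coe_eq_zero_iff]
        simp only [zsmul_eq_mul]
        exact exists_congr fun k ↦ ⟨fun h ↦ by linarith, fun h ↦ by linarith⟩
      intro z
      constructor
      · rintro ⟨x, y, rfl, N, hN⟩
        simp only [hcoe, hN]
        obtain ⟨k, hk⟩ | ⟨k, hk⟩ := N.even_or_odd
        · exact Or.inl ⟨k, by rw [hk]; push_cast; ring⟩
        · exact Or.inr ⟨k, by rw [hk]; push_cast; ring⟩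
      · obtain ⟨x, y⟩ := z
        induction x using QuotientAddGroup.induction_on with | _ x
        induction y using QuotientAddGroup.induction_on with | _ y
        rintro (h | h) <;> obtain ⟨k, hk⟩ := (hcoe _ _ _).mp h
        · exact ⟨x, y, rfl, k * 2, by rw [hk]; push_cast; ring⟩
        · exact ⟨x, y, rfl, 1 + k * 2, by rw [hk]; push_cast; ring⟩
    have hne : ((0 : ℝ) : AddCircle (2 : ℝ)) ≠ ((1 : ℝ) : AddCircle (2 : ℝ)) := by
      rw [AddCircle.coe_zero, ne_comm, Ne, AddCircle.coe_eq_zero_iff]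
      rintro ⟨k, hk⟩
      rw [zsmul_eq_mul] at hk
      have : k * 2 = 1 := by exact_mod_cast hk
      lia
    set P : AddCircle (2 : ℝ) × AddCircle (2 : ℝ) → Prop := fun z ↦
      ∃ x y : ℝ, ((x : AddCircle (2 : ℝ)), (y : AddCircle (2 : ℝ))) = z ∧
        ∃ N : ℤ, (q : ℝ) * x - (p : ℝ) * y = (N : ℝ)
    let F (c : ℝ) : Set {z // P z} := {z | q • z.1.1 - p • z.1.2 = (c : AddCircle (2 : ℝ))}
    have hclosed (c : ℝ) : IsClosed (F c) := isClosed_eq (by fun_prop) continuous_const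
    have hconn (c : ℝ) (hc : c = 0 ∨ c = 1) : IsConnected (F c) := by
      have himage : Subtype.val '' F c = {z | q • z.1 - p • z.2 = (c : AddCircle (2 : ℝ))} := by
        ext z
        refine ⟨?_, fun hz ↦ ⟨⟨z, (hmem z).mpr ?_⟩, hz, rfl⟩⟩
        · rintro ⟨w, hw, rfl⟩
          exact hw
        · rcases hc with rfl | rfl
          · exact Or.inl hz
          · exact Or.inr hz
      have h := isConnected_setOf_zsmul_sub_zsmul_eq hco 2 c
      rw [← himage] at h
      exact ⟨h.nonempty.of_image, Topology.IsInducing.subtypeVal.isPreconnected_image.mp h.2⟩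
    have hcompl : (F 0)ᶜ = F 1 := by
      ext z
      refine ⟨fun hz ↦ ((hmem z).mp z.2).resolve_left hz, fun hz hz' ↦ hne ?_⟩
      exact hz'.symm.trans hz
    exact ConnectedComponents.natCard_eq_two (hconn 0 (.inl rfl)) (hcompl ▸ hconn 1 (.inr rfl))
      (hclosed 0) (hcompl ▸ hclosed 1)
end
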